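/- For all sufficiently large n, set m = ⌊n − n^{3/4}·ln n⌋. Then for every natural number s with s < 2^m there exist two distinct primes p, ℓ ∈ 𝒫_n such that the product M = p·ℓ satisfies ⌊(M mod 2^n) / 2^{n−m}⌋ = s; that is, the bits of M at positions n−1, n−2, …, n−m (bits numbered from the right, starting at position 0) form the binary representation of s. -/

import Mathlib

/-- `𝒫 n` is the set of primes `p` with `2^(n-1) < p < 2^n`. -/
def primesP (n : ℕ) : Finset ℕ := (Finset.Ioo (2^(n-1)) (2^n)).filter Nat.Prime

lemma rsa_orth {G A : Type*} [AddCommGroup G] [Fintype G] [DecidableEq G] [Fintype A]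
    (σ : A → G) :
    ∑ ψ : AddChar G ℂ, ‖∑ a, ψ (σ a)‖ ^ 2 =
      (Fintype.card G : ℝ) *
        ((Finset.univ.filter fun q : A × A => σ q.1 = σ q.2).card : ℝ) := by
  have key : ∀ ψ : AddChar G ℂ, ((‖∑ a, ψ (σ a)‖ ^ 2 : ℝ) : ℂ) =
      ∑ q : A × A, ψ (σ q.1 - σ q.2) := by
    intro ψ
    push_cast
    rw [← Complex.mul_conj', map_sum, Finset.sum_mul_sum, ← Finset.univ_product_univ,
      Finset.sum_product]
    refine Finset.sum_congr rfl fun a _ => Finset.sum_congr rfl fun b _ => ?_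
    rw [sub_eq_add_neg, AddChar.map_add_eq_mul, AddChar.map_neg_eq_conj]
  have : ((∑ ψ : AddChar G ℂ, ‖∑ a, ψ (σ a)‖ ^ 2 : ℝ) : ℂ) =
      (((Fintype.card G : ℝ) *
        ((Finset.univ.filter fun q : A × A => σ q.1 = σ q.2).card : ℝ) : ℝ) : ℂ) := by
    rw [Complex.ofReal_sum]
    simp_rw [key]
    rw [Finset.sum_comm]
    simp_rw [AddChar.sum_apply_eq_ite, sub_eq_zero]
    rw [← Finset.sum_filter, Finset.sum_const]
    push_cast
    rw [nsmul_eq_mul, mul_comm]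
  exact_mod_cast this

lemma rsa_shift {M A : Type*} [AddCommGroup M] [DecidableEq M] [Fintype A]
    (σ : A → M) (l : M) :
    (Finset.univ.filter fun q : A × A => σ q.1 - σ q.2 = l).card ≤
      (Finset.univ.filter fun q : A × A => σ q.1 = σ q.2).card := by
  classical
  set r : M → ℕ := fun m => (Finset.univ.filter fun a : A => σ a = m).card with hr
  set S : Finset M := Finset.univ.image σ with hS
  have hcount : ∀ l : M, (Finset.univ.filter fun q : A × A => σ q.1 - σ q.2 = l).card =
      ∑ m ∈ S, r m * r (m - l) := by
    intro l
    rw [Finset.card_eq_sum_card_fiberwise (f := fun q : A × A => σ q.1) (t := S)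
      (by intro q _; simp [hS])]
    refine Finset.sum_congr rfl fun m _ => ?_
    rw [hr, ← Finset.card_product]
    congr 1
    ext ⟨a, b⟩
    simp only [Finset.mem_filter, Finset.mem_univ, true_and, Finset.mem_product]
    constructor
    · rintro ⟨h1, h2⟩
      exact ⟨h2, by rw [← h1, ← h2]; abel⟩
    · rintro ⟨h1, h2⟩
      exact ⟨by rw [h1, h2]; abel, h1⟩
  have h0 : (Finset.univ.filter fun q : A × A => σ q.1 = σ q.2).card = ∑ m ∈ S, r m ^ 2 := by
    have := hcount 0
    simp only [sub_eq_zero, sub_zero] at this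
    rw [this]
    exact Finset.sum_congr rfl fun m _ => (sq _).symm
  rw [hcount, h0]
  have h1 : ∑ m ∈ S, r (m - l) ^ 2 ≤ ∑ m ∈ S, r m ^ 2 := by
    have h2 : ∑ m ∈ S, r (m - l) ^ 2 = ∑ m ∈ S.image (fun m => m - l), r m ^ 2 := by
      refine (Finset.sum_image (f := fun m => r m ^ 2) (g := fun m => m - l) ?_).symm
      intro x _ y _ h
      simpa using h
    rw [h2]
    refine Finset.sum_le_sum_of_ne_zero ?_
    intro m _ hm
    have : r m ≠ 0 := by
      intro h; simp [h] at hm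
    rw [hr] at this
    have := Finset.card_pos.mp (Nat.pos_of_ne_zero this)
    obtain ⟨a, ha⟩ := this
    simp only [Finset.mem_filter, Finset.mem_univ, true_and] at ha
    simp [hS, ← ha]
  have h3 : 2 * ∑ m ∈ S, r m * r (m - l) ≤ ∑ m ∈ S, r m ^ 2 + ∑ m ∈ S, r (m - l) ^ 2 := by
    rw [Finset.mul_sum, ← Finset.sum_add_distrib]
    refine Finset.sum_le_sum fun m _ => ?_
    have := two_mul_le_add_sq (r m) (r (m - l))
    nlinarith
  omega

/-- vector of power sums -/
def rsaMom (D : ℕ) {ι : Type*} [Fintype ι] (x : ι → ℤ) : Fin D → ℤ :=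
  fun j => ∑ i, x i ^ (j.val + 1)

/-- Vinogradov mean value -/
def rsaJ (D b V : ℕ) : ℕ :=
  (Finset.univ.filter fun q : (Fin b → Fin V) × (Fin b → Fin V) =>
    rsaMom D (fun i => ((q.1 i : ℕ) : ℤ)) = rsaMom D (fun i => ((q.2 i : ℕ) : ℤ))).card

lemma rsa_char_prod {G A : Type*} [AddCommGroup G] [Fintype A] {ι : Type*} [Fintype ι]
    [DecidableEq ι]
    (ψ : AddChar G ℂ) (τ : ι → A → G) :
    ∏ i, ∑ a, ψ (τ i a) = ∑ x : ι → A, ψ (∑ i, τ i (x i)) := by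
  rw [Finset.prod_univ_sum, Fintype.piFinset_univ]
  refine Finset.sum_congr rfl fun x _ => ?_
  have : ∀ s : Finset ι, ψ (∑ i ∈ s, τ i (x i)) = ∏ i ∈ s, ψ (τ i (x i)) := by
    intro s
    induction s using Finset.induction_on with
    | empty => simp
    | insert a s ha ih => rw [Finset.sum_insert ha, Finset.prod_insert ha, AddChar.map_add_eq_mul, ih]
  exact (this _).symm

/-- translation of power sums -/
lemma rsa_transl {D : ℕ} {ι : Type*} [Fintype ι] {x y : ι → ℤ} (h : rsaMom D x = rsaMom D y)
    (r : ℤ) : rsaMom D (fun i => x i - r) = rsaMom D (fun i => y i - r) := by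
  have hk : ∀ k ≤ D, ∑ i, x i ^ k = ∑ i, y i ^ k := by
    intro k hk
    rcases Nat.eq_zero_or_pos k with rfl | hk0
    · simp
    · have := congrFun h ⟨k - 1, by omega⟩
      simp only [rsaMom] at this
      rwa [Nat.sub_add_cancel hk0] at this
  funext j
  simp only [rsaMom]
  have hexp : ∀ z : ι → ℤ, ∑ i, (z i - r) ^ (j.val + 1) =
      ∑ m ∈ Finset.range (j.val + 1 + 1),
        (∑ i, z i ^ m) * ((-r) ^ (j.val + 1 - m) * ((j.val + 1).choose m : ℤ)) := by
    intro z
    simp_rw [sub_eq_add_neg, add_pow, mul_assoc]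
    rw [Finset.sum_comm]
    refine Finset.sum_congr rfl fun m _ => ?_
    rw [Finset.sum_mul]
  rw [hexp, hexp]
  refine Finset.sum_congr rfl fun m hm => ?_
  rw [hk m (by have := j.2; simp at hm; omega)]

lemma rsa_pointwise {R : Type*} [Fintype R] [DecidableEq R] (g : R → ℝ) (hg : ∀ r, 0 ≤ g r) (F : ℝ) (hF0 : 0 ≤ F)
    (hF : F ≤ ∑ r, g r) (D b : ℕ) (hD : 1 ≤ D) (hb : 1 ≤ b) (hR : 1 ≤ Fintype.card R) :
    F ^ (2 * (b + D)) ≤ (2 * D : ℝ) ^ (2 * (b + D)) * ∑ r, g r ^ (2 * (b + D)) +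
      (2 * Fintype.card R : ℝ) ^ (2 * D) * (Fintype.card R : ℝ) ^ (2 * b) *
        ∑ ρ : Fin D ↪ R, ∑ r, (∏ i, g (ρ i)) ^ 2 * g r ^ (2 * b) := by
  set P : ℝ := (Fintype.card R : ℝ) with hP
  have hP1 : (1 : ℝ) ≤ P := by rw [hP]; exact_mod_cast hR
  have hD1 : (1 : ℝ) ≤ D := by exact_mod_cast hD
  set N : Finset R := Finset.univ.filter fun r => F ≤ 2 * P * g r with hN
  by_cases hcard : D ≤ N.card
  · -- good case
    have hpos : 0 ≤ (2 * D : ℝ) ^ (2 * (b + D)) * ∑ r, g r ^ (2 * (b + D)) :=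
      mul_nonneg (by positivity) (Finset.sum_nonneg fun r _ => pow_nonneg (hg r) _)
    obtain ⟨e⟩ : Nonempty (Fin D ↪ N) := by
      apply Function.Embedding.nonempty_of_card_le
      simpa using hcard
    let ρ : Fin D ↪ R := e.trans (Function.Embedding.subtype _)
    have hρ : ∀ i, F ≤ 2 * P * g (ρ i) := by
      intro i
      have := (e i).2
      simp only [hN, Finset.mem_filter] at this
      exact this.2
    have h1 : F ^ D ≤ (2 * P) ^ D * ∏ i, g (ρ i) := by
      calc F ^ D = ∏ _i : Fin D, F := by simp
        _ ≤ ∏ i : Fin D, (2 * P * g (ρ i)) :=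
          Finset.prod_le_prod (fun _ _ => hF0) (fun i _ => hρ i)
        _ = _ := by rw [Finset.prod_mul_distrib]; simp
    have h2 : F ^ (2 * b) ≤ P ^ (2 * b) * ∑ r, g r ^ (2 * b) := by
      have h3 : F ^ (2 * b) ≤ (∑ r, g r) ^ (2 * b) := pow_le_pow_left₀ hF0 hF _
      obtain ⟨c, hc⟩ : ∃ c, 2 * b = c + 1 := ⟨2 * b - 1, by omega⟩
      rw [hc] at h3 ⊢
      have h4 := pow_sum_le_card_mul_sum_pow (s := Finset.univ) (f := g) (fun i _ => hg i) c
      refine h3.trans (h4.trans ?_)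
      rw [Finset.card_univ, ← hP]
      refine mul_le_mul_of_nonneg_right ?_ (Finset.sum_nonneg fun r _ => pow_nonneg (hg r) _)
      exact pow_le_pow_right₀ hP1 (Nat.le_succ c)
    have h5 : F ^ (2 * (b + D)) ≤ ((2 * P) ^ D * ∏ i, g (ρ i)) ^ 2 * (P ^ (2 * b) * ∑ r, g r ^ (2 * b)) := by
      have : F ^ (2 * (b + D)) = (F ^ D) ^ 2 * F ^ (2 * b) := by ring
      rw [this]
      gcongr
    refine h5.trans ?_
    have h6 : ((2 * P) ^ D * ∏ i, g (ρ i)) ^ 2 * (P ^ (2 * b) * ∑ r, g r ^ (2 * b)) =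
        (2 * P) ^ (2 * D) * P ^ (2 * b) * ∑ r, (∏ i, g (ρ i)) ^ 2 * g r ^ (2 * b) := by
      rw [← Finset.mul_sum]; ring
    rw [h6]
    refine le_add_of_nonneg_of_le hpos ?_
    gcongr
    exact Finset.single_le_sum (f := fun ρ : Fin D ↪ R => ∑ r, (∏ i, g (ρ i)) ^ 2 * g r ^ (2 * b))
      (fun ρ _ => Finset.sum_nonneg fun r _ => mul_nonneg (sq_nonneg _) (pow_nonneg (hg r) _))
      (Finset.mem_univ ρ)
  · have hpos : 0 ≤ (2 * P : ℝ) ^ (2 * D) * P ^ (2 * b) *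
        ∑ ρ : Fin D ↪ R, ∑ r, (∏ i, g (ρ i)) ^ 2 * g r ^ (2 * b) :=
      mul_nonneg (by positivity) (Finset.sum_nonneg fun ρ _ => Finset.sum_nonneg fun r _ =>
        mul_nonneg (sq_nonneg _) (pow_nonneg (hg r) _))
    refine le_add_of_le_of_nonneg ?_ hpos
    push Not at hcard
    have hsplit : ∑ r, g r = ∑ r ∈ N, g r + ∑ r ∈ Nᶜ, g r := (Finset.sum_add_sum_compl N g).symm
    have h1 : ∑ r ∈ Nᶜ, g r ≤ F / 2 := by
      have : ∑ r ∈ Nᶜ, g r ≤ ∑ r ∈ Nᶜ, F / (2 * P) := by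
        refine Finset.sum_le_sum fun r hr => ?_
        rw [le_div_iff₀ (by positivity)]
        simp only [hN, Finset.mem_compl, Finset.mem_filter, Finset.mem_univ, true_and, not_le] at hr
        linarith
      refine this.trans ?_
      rw [Finset.sum_const, nsmul_eq_mul]
      have h2 : (Nᶜ.card : ℝ) ≤ P := by
        rw [hP]; exact_mod_cast Finset.card_le_univ _
      calc (Nᶜ.card : ℝ) * (F / (2 * P)) ≤ P * (F / (2 * P)) := by gcongr
        _ = F / 2 := by field_simp
    obtain ⟨r, hr⟩ : ∃ r, F ≤ 2 * D * g r := by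
      by_contra hcon
      push Not at hcon
      have hFpos : 0 < F := by
        obtain ⟨r⟩ : Nonempty R := Fintype.card_pos_iff.mp hR
        have := hcon r
        have h3 := hg r
        nlinarith [mul_nonneg (by positivity : (0:ℝ) ≤ 2 * D) h3]
      have h4 : ∑ r ∈ N, g r ≤ ∑ r ∈ N, F / (2 * D) := by
        refine Finset.sum_le_sum fun r _ => ?_
        rw [le_div_iff₀ (by positivity)]
        linarith [hcon r]
      rw [Finset.sum_const, nsmul_eq_mul] at h4
      have h5 : (N.card : ℝ) * (F / (2 * D)) < D * (F / (2 * D)) := by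
        have : (N.card : ℝ) < D := by exact_mod_cast hcard
        have : 0 < F / (2 * D) := by positivity
        gcongr
      have h6 : (D : ℝ) * (F / (2 * D)) = F / 2 := by field_simp
      linarith
    calc F ^ (2 * (b + D)) ≤ (2 * D * g r) ^ (2 * (b + D)) := pow_le_pow_left₀ hF0 hr _
      _ = (2 * D : ℝ) ^ (2 * (b + D)) * g r ^ (2 * (b + D)) := by rw [mul_pow]
      _ ≤ _ := by
        gcongr
        exact Finset.single_le_sum (f := fun r => g r ^ (2 * (b + D)))
          (fun r _ => pow_nonneg (hg r) _) (Finset.mem_univ r)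

open Polynomial in
/-- Power sums determine an unordered tuple; uniqueness with units. -/
lemma rsa_newton {S : Type*} [CommRing S] {D : ℕ} (hu : ∀ k : ℕ, 1 ≤ k → k ≤ D → IsUnit (k : S))
    (x y : Fin D → S) (h : ∀ k : ℕ, 1 ≤ k → k ≤ D → ∑ i, x i ^ k = ∑ i, y i ^ k) (t : S) :
    ∏ i, (t - x i) = ∏ i, (t - y i) := by
  have hes : ∀ k : ℕ, k ≤ D → (Multiset.map x Finset.univ.val).esymm k =
      (Multiset.map y Finset.univ.val).esymm k := by
    intro k
    induction k using Nat.strong_induction_on with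
    | _ k ih =>
      intro hk
      rcases Nat.eq_zero_or_pos k with rfl | hk0
      · simp [Multiset.esymm]
      · have hN := MvPolynomial.mul_esymm_eq_sum (Fin D) S k
        have hx := congrArg (MvPolynomial.aeval x) hN
        have hy := congrArg (MvPolynomial.aeval y) hN
        simp only [map_mul, map_natCast, map_sum, map_pow, map_neg, map_one,
          MvPolynomial.aeval_esymm_eq_multiset_esymm, MvPolynomial.psum, MvPolynomial.aeval_X] at hx hy
        have : (k : S) * (Multiset.map x Finset.univ.val).esymm k =
            (k : S) * (Multiset.map y Finset.univ.val).esymm k := by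
          rw [hx, hy]
          congr 1
          refine Finset.sum_congr rfl fun a ha => ?_
          rw [Finset.mem_filter] at ha
          have ha1 := Finset.HasAntidiagonal.mem_antidiagonal.mp ha.1
          have ha2 := ha.2
          rw [ih a.1 ha.2 (by omega), h a.2 (by omega) (by omega)]
        exact (hu k hk0 hk).mul_left_cancel this
  have hX := Multiset.prod_X_sub_X_eq_sum_esymm (Multiset.map x Finset.univ.val)
  have hY := Multiset.prod_X_sub_X_eq_sum_esymm (Multiset.map y Finset.univ.val)
  have hXY : (Multiset.map (fun t => X - C t) (Multiset.map x Finset.univ.val)).prod =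
      (Multiset.map (fun t => X - C t) (Multiset.map y Finset.univ.val)).prod := by
    rw [hX, hY]
    simp only [Multiset.card_map, Finset.card_val, Finset.card_univ, Fintype.card_fin]
    refine Finset.sum_congr rfl fun j hj => ?_
    rw [hes j (by simp at hj; omega)]
  simp only [Multiset.map_map, Function.comp_def] at hXY
  have := congrArg (Polynomial.eval t) hXY
  change eval t (∏ i, (X - C (x i))) = eval t (∏ i, (X - C (y i))) at this
  simpa [Polynomial.eval_prod] using this

lemma rsa_unique {p D : ℕ} (hp : p.Prime) (hDp : D < p) (X Y : Fin D → ℤ)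
    (hXY : ∀ i, (p : ℤ) ∣ X i - Y i) (hinj : ∀ i j, i ≠ j → ¬ (p : ℤ) ∣ X i - X j)
    (h : ∀ k : ℕ, 1 ≤ k → k ≤ D → ((p : ℤ) ^ D) ∣ ∑ i, X i ^ k - ∑ i, Y i ^ k) (i : Fin D) :
    ((p : ℤ) ^ D) ∣ X i - Y i := by
  have hunit : ∀ m : ℤ, ¬ (p : ℤ) ∣ m → IsUnit ((m : ℤ) : ZMod (p ^ D)) := by
    intro m hm
    rw [ZMod.coe_int_isUnit_iff_isCoprime]
    have : IsCoprime (p : ℤ) m := by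
      rw [Prime.coprime_iff_not_dvd (Nat.prime_iff_prime_int.mp hp)]
      exact hm
    push_cast
    exact this.pow_left
  have hprod := rsa_newton (S := ZMod (p ^ D)) (D := D) (by
      intro k hk1 hk2
      have := hunit (k : ℤ) (by
        intro hd
        have := Nat.le_of_dvd (by omega) (Int.natCast_dvd_natCast.mp hd)
        omega)
      simpa using this) (fun i => (X i : ZMod (p ^ D))) (fun i => (Y i : ZMod (p ^ D)))
    (by
      intro k hk1 hk2
      have := h k hk1 hk2
      have h2 : ((p ^ D : ℕ) : ℤ) ∣ ∑ i, X i ^ k - ∑ i, Y i ^ k := by exact_mod_cast this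
      rw [← ZMod.intCast_zmod_eq_zero_iff_dvd] at h2
      push_cast at h2
      exact sub_eq_zero.mp h2) (Y i : ZMod (p ^ D))
  have h0 : ∏ j, ((Y i : ZMod (p ^ D)) - (Y j : ZMod (p ^ D))) = 0 :=
    Finset.prod_eq_zero (Finset.mem_univ i) (sub_self _)
  rw [h0, ← Finset.mul_prod_erase _ _ (Finset.mem_univ i)] at hprod
  have hu : IsUnit (∏ j ∈ Finset.univ.erase i, ((Y i : ZMod (p ^ D)) - (X j : ZMod (p ^ D)))) := by
    rw [IsUnit.prod_iff]
    intro j hj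
    have := hunit (Y i - X j) (by
      intro hd
      have h1 := hinj i j (by rintro rfl; simp at hj)
      apply h1
      have := dvd_add (hXY i) hd
      simpa using this)
    simpa using this
  have h1 := hu.mul_left_eq_zero.mp hprod
  have h2 : ((p ^ D : ℕ) : ℤ) ∣ Y i - X i := by
    rw [← ZMod.intCast_zmod_eq_zero_iff_dvd]
    push_cast
    exact h1
  rw [← dvd_neg]
  simpa using h2

/-- integer point in a residue class -/
def rsaPt (p s : ℕ) (r : Fin p) (z : Fin (p ^ s)) : ℤ := (r : ℕ) + p * (z : ℕ)

lemma rsa_lincount {p D s : ℕ} (hp : p.Prime) (hDp : D < p) (hD : 1 ≤ D) (hs : D ≤ s + 1)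
    (ρ : Fin D ↪ Fin p) (r : ℤ) :
    (Finset.univ.filter fun q : (Fin D → Fin (p ^ s)) × (Fin D → Fin (p ^ s)) =>
      ∀ j : Fin D, ((p : ℤ) ^ (j.val + 1)) ∣
        rsaMom D (fun i => rsaPt p s (ρ i) (q.1 i) - r) j
        - rsaMom D (fun i => rsaPt p s (ρ i) (q.2 i) - r) j).card ≤
      p ^ (s * D) * (p ^ (D * (D - 1) / 2) * p ^ ((s + 1 - D) * D)) := by
  classical
  have hp0 : 0 < p := hp.pos
  have : NeZero p := ⟨hp0.ne'⟩
  set M : (Fin D → Fin (p ^ s)) → Fin D → ℤ := fun z => rsaMom D (fun i => rsaPt p s (ρ i) (z i) - r)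
    with hM
  have hfix : ∀ w : Fin D → Fin (p ^ s), (Finset.univ.filter fun z : Fin D → Fin (p ^ s) =>
      ∀ j : Fin D, ((p : ℤ) ^ (j.val + 1)) ∣ M z j - M w j).card ≤
      p ^ (D * (D - 1) / 2) * p ^ ((s + 1 - D) * D) := by
    intro w
    have hcardT : Fintype.card ((∀ j : Fin D, ZMod (p ^ (D - 1 - j.val))) × (Fin D → Fin (p ^ (s + 1 - D)))) =
        p ^ (D * (D - 1) / 2) * p ^ ((s + 1 - D) * D) := by
      rw [Fintype.card_prod, Fintype.card_pi, Fintype.card_fun, Fintype.card_fin, Fintype.card_fin]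
      congr 1
      · simp_rw [ZMod.card]
        rw [Finset.prod_pow_eq_pow_sum]
        congr 1
        rw [Fin.sum_univ_eq_sum_range (fun j => D - 1 - j) D, Finset.sum_range_reflect (fun j => j) D,
          Finset.sum_range_id]
      · rw [← pow_mul]
    rw [← hcardT, ← Finset.card_univ]
    refine Finset.card_le_card_of_injOn (fun z => (fun j => (((M z j - M w j) / (p : ℤ) ^ (j.val + 1) : ℤ) : ZMod _),
      fun i => ⟨(z i : ℕ) / p ^ (D - 1), ?_⟩)) (fun _ _ => Finset.mem_univ _) ?_
    · rw [Nat.div_lt_iff_lt_mul (by positivity), ← pow_add]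
      have : s + 1 - D + (D - 1) = s := by omega
      rw [this]; exact (z i).2
    · intro z hz z' hz' heq
      simp only [Finset.coe_filter, Finset.mem_univ, true_and, Set.mem_ofPred_eq] at hz hz'
      simp only [Prod.mk.injEq] at heq
      obtain ⟨h1, h2⟩ := heq
      have hcong : ∀ j : Fin D, ((p : ℤ) ^ D) ∣ M z j - M z' j := by
        intro j
        have h3 := congrFun h1 j
        rw [← sub_eq_zero, ← Int.cast_sub, ZMod.intCast_zmod_eq_zero_iff_dvd] at h3
        obtain ⟨a, ha⟩ := hz j
        obtain ⟨a', ha'⟩ := hz' j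
        have hpj : (p : ℤ) ^ (j.val + 1) ≠ 0 := by positivity
        rw [ha, ha', Int.mul_ediv_cancel_left _ hpj, Int.mul_ediv_cancel_left _ hpj] at h3
        have h4 : M z j - M z' j = (p : ℤ) ^ (j.val + 1) * (a - a') := by linarith
        have h5 : (p : ℤ) ^ D = (p : ℤ) ^ (j.val + 1) * (p : ℤ) ^ (D - 1 - j.val) := by
          rw [← pow_add]; congr 1; have := j.2; omega
        rw [h4, h5]
        exact mul_dvd_mul_left _ (by exact_mod_cast h3)
      have huniq := rsa_unique hp hDp (fun i => rsaPt p s (ρ i) (z i) - r) (fun i => rsaPt p s (ρ i) (z' i) - r)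
        (by intro i; refine ⟨(z i : ℕ) - (z' i : ℕ), ?_⟩; simp only [rsaPt]; ring)
        (by
          intro i j hij hd
          have h3 : (p : ℤ) ∣ ((ρ i : ℕ) : ℤ) - ((ρ j : ℕ) : ℤ) := by
            have h4 : ((ρ i : ℕ) : ℤ) - ((ρ j : ℕ) : ℤ) =
              (rsaPt p s (ρ i) (z i) - r - (rsaPt p s (ρ j) (z j) - r)) - p * ((z i : ℕ) - (z j : ℕ)) := by
              simp only [rsaPt]; ring
            rw [h4]
            exact dvd_sub hd (dvd_mul_right _ _)
          have h5 : ((ρ i : ℕ) : ℤ) - ((ρ j : ℕ) : ℤ) = 0 := by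
            apply Int.eq_zero_of_abs_lt_dvd h3
            have := (ρ i).2
            have := (ρ j).2
            rw [abs_lt]; constructor <;> omega
          apply hij
          apply ρ.injective
          apply Fin.ext
          omega)
        (by
          intro k hk1 hk2
          have := hcong ⟨k - 1, by omega⟩
          simp only [hM, rsaMom] at this
          rwa [Nat.sub_add_cancel hk1] at this)
      funext i
      apply Fin.ext
      have h3 := huniq i
      have h4 : rsaPt p s (ρ i) (z i) - r - (rsaPt p s (ρ i) (z' i) - r) = p * (((z i : ℕ) : ℤ) - ((z' i : ℕ) : ℤ)) := by
        simp only [rsaPt]; ring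
      have h5 : (p : ℤ) ^ D = p * (p : ℤ) ^ (D - 1) := by
        rw [← pow_succ']; congr 1; omega
      simp only [h4, h5] at h3
      have h6 := Int.dvd_of_mul_dvd_mul_left (by positivity : (p : ℤ) ≠ 0) h3
      have h7 := congrFun h2 i
      simp only [Fin.mk.injEq] at h7
      have h8 : (z i : ℕ) % p ^ (D - 1) = (z' i : ℕ) % p ^ (D - 1) := by
        have : ((z' i : ℕ)) ≡ (z i : ℕ) [MOD p ^ (D - 1)] := by
          rw [Nat.modEq_iff_dvd]
          exact_mod_cast h6
        exact this.symm
      rw [← Nat.div_add_mod (z i : ℕ) (p ^ (D - 1)), ← Nat.div_add_mod (z' i : ℕ) (p ^ (D - 1)), h7, h8]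
  rw [Finset.card_eq_sum_card_fiberwise (f := fun q : (Fin D → Fin (p ^ s)) × (Fin D → Fin (p ^ s)) => q.2)
    (t := Finset.univ) (fun _ _ => Finset.mem_univ _)]
  refine (Finset.sum_le_sum (fun w _ => (?_ : _ ≤ p ^ (D * (D - 1) / 2) * p ^ ((s + 1 - D) * D)))).trans ?_
  · refine le_trans ?_ (hfix w)
    refine Finset.card_le_card_of_injOn (fun q => q.1) ?_ ?_
    · rintro ⟨a, b⟩ hq
      simp only [Finset.coe_filter, Finset.mem_filter, Finset.mem_univ, true_and, Set.mem_ofPred_eq] at hq ⊢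
      obtain ⟨h1, h2⟩ := hq
      subst h2
      exact h1
    · rintro ⟨a, b⟩ hq ⟨a', b'⟩ hq' h
      simp only [Finset.coe_filter, Finset.mem_filter, Finset.mem_univ, true_and, Set.mem_ofPred_eq] at hq hq' h
      rw [Prod.mk.injEq]
      exact ⟨h, hq.2.trans hq'.2.symm⟩
  · rw [Finset.sum_const, Finset.card_univ, Fintype.card_fun, Fintype.card_fin, Fintype.card_fin, smul_eq_mul,
      ← pow_mul]

lemma rsa_exQ {A : Type*} [Fintype A] {D : ℕ} (σ : A → Fin D → ℤ) :
    ∃ Q0 : ℕ, ∀ Q : ℕ, Q0 ≤ Q → ∀ a a', (∀ j, (Q : ℤ) ∣ σ a j - σ a' j) → σ a = σ a' := by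
  refine ⟨1 + ∑ a, ∑ a', ∑ j, (σ a j - σ a' j).natAbs, ?_⟩
  intro Q hQ a a' h
  funext j
  have h1 : (σ a j - σ a' j).natAbs ≤ ∑ a, ∑ a', ∑ j, (σ a j - σ a' j).natAbs := by
    calc (σ a j - σ a' j).natAbs ≤ ∑ j, (σ a j - σ a' j).natAbs :=
          Finset.single_le_sum (f := fun j => (σ a j - σ a' j).natAbs) (fun _ _ => Nat.zero_le _) (Finset.mem_univ j)
      _ ≤ ∑ a', ∑ j, (σ a j - σ a' j).natAbs :=
          Finset.single_le_sum (f := fun a' => ∑ j, (σ a j - σ a' j).natAbs) (fun _ _ => Nat.zero_le _) (Finset.mem_univ a')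
      _ ≤ _ := Finset.single_le_sum (f := fun a => ∑ a', ∑ j, (σ a j - σ a' j).natAbs) (fun _ _ => Nat.zero_le _) (Finset.mem_univ a)
  have h2 : σ a j - σ a' j = 0 := by
    apply Int.eq_zero_of_abs_lt_dvd (h j)
    rw [Int.abs_eq_natAbs]
    omega
  omega

/-- power vector mod Q -/
def rsaVec (D Q : ℕ) (v : ℤ) : Fin D → ZMod Q := fun j => ((v ^ (j.val + 1) : ℤ) : ZMod Q)

lemma rsa_vec_sum (D Q : ℕ) {ι : Type*} [Fintype ι] (x : ι → ℤ) :
    ∑ i, rsaVec D Q (x i) = fun j => ((rsaMom D x j : ℤ) : ZMod Q) := by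
  funext j
  simp [rsaVec, rsaMom, Finset.sum_apply]

lemma rsa_fourier_count (D Q : ℕ) [NeZero Q] {ι A : Type*} [Fintype ι] [DecidableEq ι] [Fintype A]
    (pt : ι → A → ℤ) :
    ∑ ψ : AddChar (Fin D → ZMod Q) ℂ, ‖∏ i, ∑ a, ψ (rsaVec D Q (pt i a))‖ ^ 2 =
      (Q : ℝ) ^ D * ((Finset.univ.filter fun q : (ι → A) × (ι → A) =>
        (∀ j, (Q : ℤ) ∣ rsaMom D (fun i => pt i (q.1 i)) j - rsaMom D (fun i => pt i (q.2 i)) j)).card : ℝ) := by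
  simp_rw [rsa_char_prod, rsa_vec_sum]
  rw [rsa_orth]
  congr 1
  · simp [ZMod.card]
  · congr 2
    ext q
    simp only [Finset.mem_filter, Finset.mem_univ, true_and, funext_iff]
    refine forall_congr' fun j => ?_
    rw [← sub_eq_zero, ← Int.cast_sub, ZMod.intCast_zmod_eq_zero_iff_dvd]

lemma rsa_mom_class {p D s : ℕ} (r : Fin p) {ι : Type*} [Fintype ι] (z : ι → Fin (p ^ s)) (j : Fin D) :
    rsaMom D (fun i => rsaPt p s r (z i) - ((r : ℕ) : ℤ)) j =
      (p : ℤ) ^ (j.val + 1) * rsaMom D (fun i => ((z i : ℕ) : ℤ)) j := by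
  simp only [rsaMom, rsaPt, Finset.mul_sum]
  refine Finset.sum_congr rfl fun i _ => ?_
  rw [← mul_pow]; congr 1; ring

lemma rsa_badcount {p D s b : ℕ} (hp : 0 < p) (r : Fin p) :
    (Finset.univ.filter fun q : (Fin b → Fin (p ^ s)) × (Fin b → Fin (p ^ s)) =>
      rsaMom D (fun i => rsaPt p s r (q.1 i)) = rsaMom D (fun i => rsaPt p s r (q.2 i))).card ≤
      rsaJ D b (p ^ s) := by
  refine Finset.card_le_card ?_
  intro q hq
  simp only [Finset.mem_filter, Finset.mem_univ, true_and] at hq ⊢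
  have := rsa_transl hq ((r : ℕ) : ℤ)
  funext j
  have h := congrFun this j
  rw [rsa_mom_class, rsa_mom_class] at h
  exact mul_left_cancel₀ (by positivity) h

lemma rsa_goodcount {p D s b : ℕ} (hp : p.Prime) (hDp : D < p) (hD : 1 ≤ D) (hs : D ≤ s + 1)
    (ρ : Fin D ↪ Fin p) (r : Fin p) :
    (Finset.univ.filter fun q : (Fin D ⊕ Fin b → Fin (p ^ s)) × (Fin D ⊕ Fin b → Fin (p ^ s)) =>
      rsaMom D (fun i => rsaPt p s (Sum.elim ρ (fun _ => r) i) (q.1 i)) =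
      rsaMom D (fun i => rsaPt p s (Sum.elim ρ (fun _ => r) i) (q.2 i))).card ≤
      rsaJ D b (p ^ s) * (p ^ (s * D) * (p ^ (D * (D - 1) / 2) * p ^ ((s + 1 - D) * D))) := by
  classical
  have hp0 := hp.pos
  have hpj : ∀ j : Fin D, (p : ℤ) ^ (j.val + 1) ≠ 0 := fun j => by positivity
  have hsplit : ∀ (z : Fin D ⊕ Fin b → Fin (p ^ s)) (j : Fin D),
      rsaMom D (fun i => rsaPt p s (Sum.elim ρ (fun _ => r) i) (z i) - ((r : ℕ) : ℤ)) j =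
      rsaMom D (fun i => rsaPt p s (ρ i) (z (Sum.inl i)) - ((r : ℕ) : ℤ)) j +
      (p : ℤ) ^ (j.val + 1) * rsaMom D (fun i => ((z (Sum.inr i) : ℕ) : ℤ)) j := by
    intro z j
    rw [← rsa_mom_class r]
    simp only [rsaMom, Fintype.sum_sum_type, Sum.elim_inl, Sum.elim_inr]
  refine le_trans ?_ (Nat.mul_le_mul_left _ (rsa_lincount hp hDp hD hs ρ ((r : ℕ) : ℤ)))
  refine Finset.card_le_mul_card_image_of_maps_to
    (f := fun q => ((fun i => q.1 (Sum.inl i)), (fun i => q.2 (Sum.inl i)))) ?_ _ ?_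
  · intro q hq
    simp only [Finset.mem_filter, Finset.mem_univ, true_and] at hq ⊢
    intro j
    have h := congrFun (rsa_transl hq ((r : ℕ) : ℤ)) j
    rw [hsplit, hsplit] at h
    refine ⟨rsaMom D (fun i => ((q.2 (Sum.inr i) : ℕ) : ℤ)) j - rsaMom D (fun i => ((q.1 (Sum.inr i) : ℕ) : ℤ)) j, ?_⟩
    linarith
  · rintro ⟨x, x'⟩ _
    refine le_trans ?_ (rsa_shift (fun y : Fin b → Fin (p ^ s) => rsaMom D (fun i => ((y i : ℕ) : ℤ)))
      (fun j => (rsaMom D (fun i => rsaPt p s (ρ i) (x' i) - ((r : ℕ) : ℤ)) j -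
        rsaMom D (fun i => rsaPt p s (ρ i) (x i) - ((r : ℕ) : ℤ)) j) / (p : ℤ) ^ (j.val + 1)))
    refine Finset.card_le_card_of_injOn
      (fun q => ((fun i => q.1 (Sum.inr i)), (fun i => q.2 (Sum.inr i)))) ?_ ?_
    · intro q hq
      simp only [Finset.coe_filter, Finset.mem_filter, Finset.mem_univ, true_and, Set.mem_ofPred_eq,
        Prod.mk.injEq] at hq ⊢
      obtain ⟨h1, h2, h3⟩ := hq
      funext j
      have h := congrFun (rsa_transl h1 ((r : ℕ) : ℤ)) j
      rw [hsplit, hsplit] at h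
      subst h2 h3
      symm
      apply Int.ediv_eq_of_eq_mul_right (hpj j)
      simp only [Pi.sub_apply]
      linarith
    · intro q hq q' hq' h
      simp only [Finset.coe_filter, Finset.mem_filter, Finset.mem_univ, true_and, Set.mem_ofPred_eq,
        Prod.mk.injEq] at hq hq' h
      refine Prod.ext ?_ ?_
      · funext i
        rcases i with i | i
        · exact (congrFun hq.2.1 i).trans (congrFun hq'.2.1 i).symm
        · exact congrFun h.1 i
      · funext i
        rcases i with i | i
        · exact (congrFun hq.2.2 i).trans (congrFun hq'.2.2 i).symm
        · exact congrFun h.2 i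

lemma rsa_rec {p D s b : ℕ} (hp : p.Prime) (hDp : D < p) (hD : 1 ≤ D) (hb : 1 ≤ b) (hs : D ≤ s + 1) :
    (rsaJ D (b + D) (p ^ (s + 1)) : ℝ) ≤
      (2 * D : ℝ) ^ (2 * (b + D)) * ((p : ℝ) * (((p : ℝ) ^ s) ^ (2 * D) * rsaJ D b (p ^ s))) +
      (2 * p : ℝ) ^ (2 * D) * (p : ℝ) ^ (2 * b) * ((p : ℝ) ^ D * ((p : ℝ) *
        (rsaJ D b (p ^ s) * ((p : ℝ) ^ (s * D) * ((p : ℝ) ^ (D * (D - 1) / 2) * (p : ℝ) ^ ((s + 1 - D) * D)))))) := by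
  classical
  have hp0 := hp.pos
  -- choose Q
  obtain ⟨Q1, hQ1⟩ := rsa_exQ (D := D) (fun a : Fin p × (Fin b → Fin (p ^ s)) =>
    rsaMom D (fun i => rsaPt p s a.1 (a.2 i)))
  obtain ⟨Q2, hQ2⟩ := rsa_exQ (D := D) (fun a : (Fin D ↪ Fin p) × Fin p × (Fin D ⊕ Fin b → Fin (p ^ s)) =>
    rsaMom D (fun i => rsaPt p s (Sum.elim a.1 (fun _ => a.2.1) i) (a.2.2 i)))
  set Q := Q1 + Q2 + 1 with hQ
  have : NeZero Q := ⟨by omega⟩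
  have hQpos : (0 : ℝ) < (Q : ℝ) ^ D := by positivity
  set f : AddChar (Fin D → ZMod Q) ℂ → Fin p → ℂ := fun ψ r => ∑ z, ψ (rsaVec D Q (rsaPt p s r z)) with hf
  have hbad : ∀ r : Fin p, ∑ ψ, ‖f ψ r‖ ^ (2 * b) ≤ (Q : ℝ) ^ D * rsaJ D b (p ^ s) := by
    intro r
    have h1 := rsa_fourier_count D Q (ι := Fin b) (fun _ => rsaPt p s r)
    have h2 : ∀ ψ : AddChar (Fin D → ZMod Q) ℂ, ‖∏ _i : Fin b, ∑ a, ψ (rsaVec D Q (rsaPt p s r a))‖ ^ 2 = ‖f ψ r‖ ^ (2 * b) := by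
      intro ψ
      rw [Finset.prod_const, Finset.card_univ, Fintype.card_fin, norm_pow, ← pow_mul, mul_comm b 2]
    simp_rw [h2] at h1
    rw [h1]
    gcongr
    refine le_trans (Finset.card_le_card ?_) (rsa_badcount hp0 r)
    intro q hq
    simp only [Finset.mem_filter, Finset.mem_univ, true_and] at hq ⊢
    exact hQ1 Q (by omega) (r, q.1) (r, q.2) hq
  have hgood : ∀ (ρ : Fin D ↪ Fin p) (r : Fin p), ∑ ψ, (∏ i, ‖f ψ (ρ i)‖) ^ 2 * ‖f ψ r‖ ^ (2 * b) ≤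
      (Q : ℝ) ^ D * (rsaJ D b (p ^ s) * ((p : ℝ) ^ (s * D) * ((p : ℝ) ^ (D * (D - 1) / 2) * (p : ℝ) ^ ((s + 1 - D) * D)))) := by
    intro ρ r
    have h1 := rsa_fourier_count D Q (ι := Fin D ⊕ Fin b) (fun i => rsaPt p s (Sum.elim ρ (fun _ => r) i))
    have h2 : ∀ ψ : AddChar (Fin D → ZMod Q) ℂ, ‖∏ i : Fin D ⊕ Fin b, ∑ a, ψ (rsaVec D Q (rsaPt p s (Sum.elim ρ (fun _ => r) i) a))‖ ^ 2 =
        (∏ i, ‖f ψ (ρ i)‖) ^ 2 * ‖f ψ r‖ ^ (2 * b) := by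
      intro ψ
      rw [Fintype.prod_sum_type]
      simp only [Sum.elim_inl, Sum.elim_inr]
      rw [Finset.prod_const, Finset.card_univ, Fintype.card_fin, norm_mul, norm_pow, norm_prod, mul_pow, ← pow_mul, mul_comm b 2]
    simp_rw [h2] at h1
    rw [h1]
    gcongr
    have h3 := rsa_goodcount (b := b) hp hDp hD hs ρ r
    have h4 : ((Finset.univ.filter fun q : (Fin D ⊕ Fin b → Fin (p ^ s)) × (Fin D ⊕ Fin b → Fin (p ^ s)) =>
        ∀ j, (Q : ℤ) ∣ rsaMom D (fun i => rsaPt p s (Sum.elim ρ (fun _ => r) i) (q.1 i)) j -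
      rsaMom D (fun i => rsaPt p s (Sum.elim ρ (fun _ => r) i) (q.2 i)) j)).card ≤ rsaJ D b (p ^ s) * (p ^ (s * D) * (p ^ (D * (D - 1) / 2) * p ^ ((s + 1 - D) * D))) := by
      refine le_trans (Finset.card_le_card ?_) h3
      intro q hq
      simp only [Finset.mem_filter, Finset.mem_univ, true_and] at hq ⊢
      exact hQ2 Q (by omega) (ρ, r, q.1) (ρ, r, q.2) hq
    exact_mod_cast h4
  have hfle : ∀ ψ r, ‖f ψ r‖ ≤ (p : ℝ) ^ s := by
    intro ψ r
    refine (norm_sum_le _ _).trans ?_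
    simp [AddChar.norm_apply]
  have hFsum : ∀ ψ : AddChar (Fin D → ZMod Q) ℂ, ∑ v : Fin (p ^ (s + 1)), ψ (rsaVec D Q ((v : ℕ) : ℤ)) = ∑ r, f ψ r := by
    intro ψ
    simp only [hf]
    rw [← Fintype.sum_prod_type']
    refine (Fintype.sum_equiv ((Equiv.prodComm _ _).trans (finProdFinEquiv.trans (finCongr (by rw [pow_succ])))) _ _ ?_).symm
    rintro ⟨r, z⟩
    simp [rsaPt, finProdFinEquiv]
  have hmain : (Q : ℝ) ^ D * (rsaJ D (b + D) (p ^ (s + 1)) : ℝ) ≤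
      ∑ ψ : AddChar (Fin D → ZMod Q) ℂ, ‖∑ r, f ψ r‖ ^ (2 * (b + D)) := by
    have h1 := rsa_fourier_count D Q (ι := Fin (b + D)) (A := Fin (p ^ (s + 1))) (fun _ a => ((a : ℕ) : ℤ))
    have h2 : ∀ ψ : AddChar (Fin D → ZMod Q) ℂ, ‖∏ _i : Fin (b + D), ∑ a : Fin (p ^ (s + 1)), ψ (rsaVec D Q ((a : ℕ) : ℤ))‖ ^ 2 =
        ‖∑ r, f ψ r‖ ^ (2 * (b + D)) := by
      intro ψ
      rw [Finset.prod_const, Finset.card_univ, Fintype.card_fin, norm_pow, ← pow_mul, mul_comm (b + D) 2, hFsum]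
    simp_rw [h2] at h1
    rw [h1, rsaJ]
    gcongr
    intro h j
    rw [h]; simp
  have hpt : ∀ ψ : AddChar (Fin D → ZMod Q) ℂ, ‖∑ r, f ψ r‖ ^ (2 * (b + D)) ≤
      (2 * D : ℝ) ^ (2 * (b + D)) * ∑ r, ((p : ℝ) ^ s) ^ (2 * D) * ‖f ψ r‖ ^ (2 * b) +
      (2 * p : ℝ) ^ (2 * D) * (p : ℝ) ^ (2 * b) *
        ∑ ρ : Fin D ↪ Fin p, ∑ r, (∏ i, ‖f ψ (ρ i)‖) ^ 2 * ‖f ψ r‖ ^ (2 * b) := by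
    intro ψ
    have h := rsa_pointwise (fun r => ‖f ψ r‖) (fun r => norm_nonneg _) ‖∑ r, f ψ r‖ (norm_nonneg _)
      (norm_sum_le _ _) D b hD hb (by rw [Fintype.card_fin]; exact hp0)
    simp only [Fintype.card_fin] at h
    refine h.trans ?_
    gcongr with r
    rw [mul_add, pow_add, mul_comm]
    gcongr
    exact hfle ψ r
  have hsum := hmain.trans (Finset.sum_le_sum fun ψ _ => hpt ψ)
  rw [Finset.sum_add_distrib, ← Finset.mul_sum, ← Finset.mul_sum, Finset.sum_comm] at hsum
  have e1 : ∑ r : Fin p, ∑ ψ : AddChar (Fin D → ZMod Q) ℂ, ((p : ℝ) ^ s) ^ (2 * D) * ‖f ψ r‖ ^ (2 * b) ≤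
      (p : ℝ) * (((p : ℝ) ^ s) ^ (2 * D) * ((Q : ℝ) ^ D * rsaJ D b (p ^ s))) := by
    calc _ ≤ ∑ r : Fin p, (((p : ℝ) ^ s) ^ (2 * D) * ((Q : ℝ) ^ D * rsaJ D b (p ^ s))) := by
          refine Finset.sum_le_sum fun r _ => ?_
          rw [← Finset.mul_sum]
          gcongr
          exact hbad r
      _ = _ := by simp
  have e2 : ∑ ψ : AddChar (Fin D → ZMod Q) ℂ, ∑ ρ : Fin D ↪ Fin p, ∑ r, (∏ i, ‖f ψ (ρ i)‖) ^ 2 * ‖f ψ r‖ ^ (2 * b) ≤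
      (p : ℝ) ^ D * ((p : ℝ) * ((Q : ℝ) ^ D * (rsaJ D b (p ^ s) * ((p : ℝ) ^ (s * D) * ((p : ℝ) ^ (D * (D - 1) / 2) * (p : ℝ) ^ ((s + 1 - D) * D)))))) := by
    rw [Finset.sum_comm]
    have e3 : ∀ ρ : Fin D ↪ Fin p, ∑ ψ : AddChar (Fin D → ZMod Q) ℂ, ∑ r, (∏ i, ‖f ψ (ρ i)‖) ^ 2 * ‖f ψ r‖ ^ (2 * b) ≤
        (p : ℝ) * ((Q : ℝ) ^ D * (rsaJ D b (p ^ s) * ((p : ℝ) ^ (s * D) * ((p : ℝ) ^ (D * (D - 1) / 2) * (p : ℝ) ^ ((s + 1 - D) * D))))) := by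
      intro ρ
      rw [Finset.sum_comm]
      refine (Finset.sum_le_sum fun r _ => hgood ρ r).trans ?_
      simp
    refine (Finset.sum_le_sum fun ρ _ => e3 ρ).trans ?_
    rw [Finset.sum_const, nsmul_eq_mul]
    gcongr
    rw [Finset.card_univ, Fintype.card_embedding_eq]
    simp only [Fintype.card_fin]
    exact_mod_cast Nat.descFactorial_le_pow p D
  have hfin : (Q : ℝ) ^ D * (rsaJ D (b + D) (p ^ (s + 1)) : ℝ) ≤ (Q : ℝ) ^ D * (
      (2 * D : ℝ) ^ (2 * (b + D)) * ((p : ℝ) * (((p : ℝ) ^ s) ^ (2 * D) * rsaJ D b (p ^ s))) +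
      (2 * p : ℝ) ^ (2 * D) * (p : ℝ) ^ (2 * b) * ((p : ℝ) ^ D * ((p : ℝ) *
        (rsaJ D b (p ^ s) * ((p : ℝ) ^ (s * D) * ((p : ℝ) ^ (D * (D - 1) / 2) * (p : ℝ) ^ ((s + 1 - D) * D))))))) := by
    refine hsum.trans ?_
    have m1 := mul_le_mul_of_nonneg_left e1 (by positivity : (0:ℝ) ≤ (2 * D : ℝ) ^ (2 * (b + D)))
    have m2 := mul_le_mul_of_nonneg_left e2 (by positivity : (0:ℝ) ≤ (2 * p : ℝ) ^ (2 * D) * (p : ℝ) ^ (2 * b))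
    refine (add_le_add m1 m2).trans (le_of_eq ?_)
    ring
  exact le_of_mul_le_mul_left hfin hQpos

lemma rsa_step {p d s b : ℕ} (hp : p.Prime) (hd : 1 ≤ d) (hDp : 6 * d < p) (hb : (6 * d) ^ 2 ≤ b)
    (hbu : b + 6 * d ≤ 120 * (6 * d) ^ 2) (hs : 6 * d ≤ s) :
    rsaJ (6 * d) (b + 6 * d) (p ^ (s + 1)) * p ^ (18 * d ^ 2) ≤
      (12 * d) ^ (241 * (6 * d) ^ 2) * p ^ (2 * b + 2 * s * (6 * d) + 5 * (6 * d)) *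
        rsaJ (6 * d) b (p ^ s) := by
  have hp1 : 1 ≤ p := hp.one_lt.le
  have h := rsa_rec (D := 6 * d) (b := b) (s := s) hp hDp (by omega) (by nlinarith) (by omega)
  have h' : rsaJ (6 * d) (b + 6 * d) (p ^ (s + 1)) ≤ (2 * (6 * d)) ^ (2 * (b + 6 * d)) * (p * ((p ^ s) ^ (2 * (6 * d)) * rsaJ (6 * d) b (p ^ s))) +
      (2 * p) ^ (2 * (6 * d)) * p ^ (2 * b) * (p ^ (6 * d) * (p * (rsaJ (6 * d) b (p ^ s) * (p ^ (s * (6 * d)) * (p ^ (6 * d * (6 * d - 1) / 2) * p ^ ((s + 1 - 6 * d) * (6 * d))))))) := by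
    exact_mod_cast h
  set J := rsaJ (6 * d) b (p ^ s)
  have e1 : 6 * d * (6 * d - 1) / 2 + 18 * d ^ 2 = 36 * d ^ 2 - 3 * d := by
    have : 6 * d * (6 * d - 1) = 2 * (18 * d ^ 2 - 3 * d) := by
      obtain ⟨e, rfl⟩ := Nat.exists_eq_add_of_le' hd
      have : 6 * (e + 1) - 1 = 6 * e + 5 := by omega
      rw [this]
      have : 18 * (e+1)^2 - 3 * (e+1) = (e+1) * (18 * e + 15) := by
        rw [Nat.sub_eq_iff_eq_add (by nlinarith)]; ring
      rw [this]; ring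
    rw [this, Nat.mul_div_cancel_left _ (by norm_num)]
    have : 3 * d ≤ 18 * d ^ 2 := by nlinarith
    omega
  have e2 : (s + 1 - 6 * d) * (6 * d) + 36 * d ^ 2 = (s + 1) * (6 * d) := by
    obtain ⟨e, he⟩ := Nat.exists_eq_add_of_le (show 6 * d ≤ s + 1 by omega)
    rw [he, Nat.add_sub_cancel_left]; ring
  have hX : p ^ (1 + 2 * s * (6 * d) + 18 * d ^ 2) ≤ p ^ (2 * b + 2 * s * (6 * d) + 5 * (6 * d)) := by
    apply Nat.pow_le_pow_right hp1
    nlinarith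
  have hY : p ^ (2 * (6 * d) + 2 * b + 6 * d + 1 + s * (6 * d) + (6 * d * (6 * d - 1) / 2) + (s + 1 - 6 * d) * (6 * d) + 18 * d ^ 2) ≤
      p ^ (2 * b + 2 * s * (6 * d) + 5 * (6 * d)) := by
    apply Nat.pow_le_pow_right hp1
    have : 3 * d ≤ 36 * d ^ 2 := by nlinarith
    have e3 : (s + 1) * (6 * d) = s * (6 * d) + 6 * d := by ring
    have e4 : 2 * s * (6 * d) = 2 * (s * (6 * d)) := by ring
    omega
  have hK : (12 * d) ^ (2 * (b + 6 * d)) + 2 ^ (2 * (6 * d)) ≤ (12 * d) ^ (241 * (6 * d) ^ 2) := by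
    calc (12 * d) ^ (2 * (b + 6 * d)) + 2 ^ (2 * (6 * d)) ≤ (12 * d) ^ (2 * (b + 6 * d)) + (12 * d) ^ (2 * (b + 6 * d)) := by
          refine Nat.add_le_add_left ?_ _
          calc 2 ^ (2 * (6 * d)) ≤ (12 * d) ^ (2 * (6 * d)) := by gcongr; omega
            _ ≤ _ := Nat.pow_le_pow_right (by omega) (by omega)
      _ ≤ (12 * d) ^ (2 * (b + 6 * d)) * (12 * d) := by nlinarith [pow_pos (show 0 < 12 * d by omega) (2 * (b + 6 * d))]
      _ = (12 * d) ^ (2 * (b + 6 * d) + 1) := by rw [pow_succ]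
      _ ≤ _ := by
        apply Nat.pow_le_pow_right (by omega)
        have : 1 ≤ (6 * d) ^ 2 := Nat.one_le_pow _ _ (by omega)
        omega
  calc _ ≤ _ := Nat.mul_le_mul_right _ h'
    _ = (12 * d) ^ (2 * (b + 6 * d)) * p ^ (1 + 2 * s * (6 * d) + 18 * d ^ 2) * J +
        2 ^ (2 * (6 * d)) * p ^ (2 * (6 * d) + 2 * b + 6 * d + 1 + s * (6 * d) + (6 * d * (6 * d - 1) / 2) + (s + 1 - 6 * d) * (6 * d) + 18 * d ^ 2) * J := by
      generalize 6 * d * (6 * d - 1) / 2 = u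
      generalize (s + 1 - 6 * d) * (6 * d) = w
      generalize 2 * (b + 6 * d) = v
      rw [show 2 * (6 * d) = 12 * d by ring]
      generalize (12 * d) ^ v = v'
      ring
    _ ≤ (12 * d) ^ (2 * (b + 6 * d)) * p ^ (2 * b + 2 * s * (6 * d) + 5 * (6 * d)) * J +
        2 ^ (2 * (6 * d)) * p ^ (2 * b + 2 * s * (6 * d) + 5 * (6 * d)) * J := by gcongr
    _ = ((12 * d) ^ (2 * (b + 6 * d)) + 2 ^ (2 * (6 * d))) * p ^ (2 * b + 2 * s * (6 * d) + 5 * (6 * d)) * J := by ring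
    _ ≤ _ := by gcongr

lemma rsa_vmvt {p d : ℕ} (hp : p.Prime) (hd : 1 ≤ d) (hDp : 6 * d < p) (R : ℕ) (hR : R ≤ 119 * (6 * d)) :
    rsaJ (6 * d) ((6 * d) ^ 2 + R * (6 * d)) (p ^ (6 * d + R)) * p ^ (18 * d ^ 2 * R) ≤
      ((12 * d) ^ (241 * (6 * d) ^ 2)) ^ R *
        p ^ (2 * ((6 * d) ^ 2 + R * (6 * d)) * (6 * d + R) + 3 * (6 * d) * R) := by
  induction R with
  | zero =>
    simp only [mul_zero, pow_zero, mul_one, zero_mul, add_zero, one_mul]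
    have : rsaJ (6 * d) ((6 * d) ^ 2) (p ^ (6 * d)) ≤ Fintype.card ((Fin ((6 * d) ^ 2) → Fin (p ^ (6 * d))) × (Fin ((6 * d) ^ 2) → Fin (p ^ (6 * d)))) :=
      Finset.card_le_univ _
    refine this.trans (le_of_eq ?_)
    simp only [Fintype.card_prod, Fintype.card_fun, Fintype.card_fin]
    rw [← pow_mul, ← pow_add]
    congr 1
    ring
  | succ R ih =>
    have ih := ih (by omega)
    have h := rsa_step (b := (6 * d) ^ 2 + R * (6 * d)) (s := 6 * d + R) hp hd hDp (by omega) (by nlinarith) (by omega)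
    have e1 : (6 * d) ^ 2 + (R + 1) * (6 * d) = (6 * d) ^ 2 + R * (6 * d) + 6 * d := by ring
    rw [e1, ← add_assoc (6 * d) R 1]
    set b := (6 * d) ^ 2 + R * (6 * d)
    set K := (12 * d) ^ (241 * (6 * d) ^ 2)
    calc _ = (rsaJ (6 * d) (b + 6 * d) (p ^ (6 * d + R + 1)) * p ^ (18 * d ^ 2)) * p ^ (18 * d ^ 2 * R) := by
          rw [mul_add (18 * d ^ 2), pow_add]; ring
      _ ≤ (K * p ^ (2 * b + 2 * (6 * d + R) * (6 * d) + 5 * (6 * d)) * rsaJ (6 * d) b (p ^ (6 * d + R))) * p ^ (18 * d ^ 2 * R) := by gcongr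
      _ = K * p ^ (2 * b + 2 * (6 * d + R) * (6 * d) + 5 * (6 * d)) * (rsaJ (6 * d) b (p ^ (6 * d + R)) * p ^ (18 * d ^ 2 * R)) := by ring
      _ ≤ K * p ^ (2 * b + 2 * (6 * d + R) * (6 * d) + 5 * (6 * d)) * (K ^ R * p ^ (2 * b * (6 * d + R) + 3 * (6 * d) * R)) := by gcongr
      _ = K ^ (R + 1) * p ^ (2 * b + 2 * (6 * d + R) * (6 * d) + 5 * (6 * d) + (2 * b * (6 * d + R) + 3 * (6 * d) * R)) := by
        rw [pow_add p, pow_succ]; ring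
      _ = _ := by
        congr 2
        ring

/-- the additive character exp(2 pi i x) -/
noncomputable def rsaE (x : ℝ) : ℂ := Complex.exp (2 * Real.pi * x * Complex.I)

lemma rsaE_add (x y : ℝ) : rsaE (x + y) = rsaE x * rsaE y := by
  rw [rsaE, rsaE, rsaE, ← Complex.exp_add]; congr 1; push_cast; ring

lemma rsaE_zero : rsaE 0 = 1 := by simp [rsaE]

lemma rsaE_norm (x : ℝ) : ‖rsaE x‖ = 1 := by
  rw [rsaE, show (2 * Real.pi * x * Complex.I : ℂ) = ((2 * Real.pi * x : ℝ) : ℂ) * Complex.I by push_cast; ring]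
  exact Complex.norm_exp_ofReal_mul_I _

lemma rsaE_neg (x : ℝ) : rsaE (-x) = (starRingEnd ℂ) (rsaE x) := by
  rw [rsaE, rsaE, ← Complex.exp_conj]; congr 1; simp [Complex.conj_ofNat]

lemma rsaE_sub (x y : ℝ) : rsaE (x - y) = rsaE x * (starRingEnd ℂ) (rsaE y) := by
  rw [sub_eq_add_neg, rsaE_add, rsaE_neg]

lemma rsaE_int (m : ℤ) : rsaE m = 1 := by
  rw [rsaE, show (2 * Real.pi * ((m : ℝ) : ℂ) * Complex.I : ℂ) = m * (2 * Real.pi * Complex.I) by push_cast; ring]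
  exact Complex.exp_int_mul_two_pi_mul_I m

lemma rsaE_add_int (x : ℝ) (m : ℤ) : rsaE (x + m) = rsaE x := by
  rw [rsaE_add, rsaE_int, mul_one]

lemma rsaE_sum {ι : Type*} (s : Finset ι) (f : ι → ℝ) : rsaE (∑ i ∈ s, f i) = ∏ i ∈ s, rsaE (f i) := by
  classical
  induction s using Finset.induction_on with
  | empty => simp [rsaE_zero]
  | insert a s ha ih => rw [Finset.sum_insert ha, Finset.prod_insert ha, rsaE_add, ih]

/-- Weyl sum -/
noncomputable def rsaH (D V : ℕ) (θ : Fin D → ℝ) : ℂ := ∑ u : Fin V, rsaE (∑ j, θ j * ((u : ℕ) : ℝ) ^ (j.val + 1))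

/-- moment difference -/
def rsaDel (D b V : ℕ) (q : (Fin b → Fin V) × (Fin b → Fin V)) : Fin D → ℤ :=
  rsaMom D (fun i => ((q.1 i : ℕ) : ℤ)) - rsaMom D (fun i => ((q.2 i : ℕ) : ℤ))

lemma rsaH_pow (D b V : ℕ) (θ : Fin D → ℝ) :
    ((‖rsaH D V θ‖ ^ (2 * b) : ℝ) : ℂ) = ∑ q : (Fin b → Fin V) × (Fin b → Fin V), rsaE (∑ j, θ j * (rsaDel D b V q j : ℝ)) := by
  have h1 : rsaH D V θ ^ b = ∑ x : Fin b → Fin V, rsaE (∑ j, θ j * (rsaMom D (fun i => ((x i : ℕ) : ℤ)) j : ℝ)) := by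
    rw [rsaH, ← Fin.prod_const, Finset.prod_univ_sum, Fintype.piFinset_univ]
    refine Finset.sum_congr rfl fun x _ => ?_
    rw [← rsaE_sum, Finset.sum_comm]
    congr 1
    refine Finset.sum_congr rfl fun j _ => ?_
    rw [← Finset.mul_sum]
    simp [rsaMom]
  rw [mul_comm 2 b, pow_mul, ← norm_pow]
  push_cast
  rw [← Complex.mul_conj', h1, map_sum, Finset.sum_mul_sum, ← Finset.univ_product_univ,
      Finset.sum_product]
  refine Finset.sum_congr rfl fun x _ => Finset.sum_congr rfl fun y _ => ?_
  rw [← rsaE_sub]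
  congr 1
  rw [← Finset.sum_sub_distrib]
  refine Finset.sum_congr rfl fun j _ => ?_
  simp [rsaDel]; ring

/-- box -/
noncomputable def rsaBox (D b V : ℕ) : Finset (Fin D → ℤ) :=
  Fintype.piFinset fun j => Finset.Icc (-((b * V ^ (j.val + 1) : ℕ) : ℤ)) ((b * V ^ (j.val + 1) : ℕ) : ℤ)

lemma rsaDel_mem (D b V : ℕ) (q : (Fin b → Fin V) × (Fin b → Fin V)) : rsaDel D b V q ∈ rsaBox D b V := by
  rw [rsaBox, Fintype.mem_piFinset]
  intro j
  have h : ∀ x : Fin b → Fin V, 0 ≤ rsaMom D (fun i => ((x i : ℕ) : ℤ)) j ∧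
      rsaMom D (fun i => ((x i : ℕ) : ℤ)) j ≤ ((b * V ^ (j.val + 1) : ℕ) : ℤ) := by
    intro x
    refine ⟨Finset.sum_nonneg fun i _ => by positivity, ?_⟩
    calc _ ≤ ∑ i : Fin b, (V : ℤ) ^ (j.val + 1) := by
          refine Finset.sum_le_sum fun i _ => ?_
          gcongr
          exact Int.ofNat_le.mpr (x i).2.le
      _ = _ := by simp
  have h1 := h q.1
  have h2 := h q.2
  simp only [rsaDel, Pi.sub_apply, Finset.mem_Icc]
  constructor <;> linarith

lemma rsa_fiber (D b V : ℕ) (f : (Fin D → ℤ) → ℝ) (hf : ∀ l, 0 ≤ f l) :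
    ∑ q, f (rsaDel D b V q) ≤ rsaJ D b V * ∑ l ∈ rsaBox D b V, f l := by
  rw [← Finset.sum_fiberwise_of_maps_to (s := Finset.univ) (t := rsaBox D b V) (g := rsaDel D b V) (fun q _ => rsaDel_mem D b V q), Finset.mul_sum]
  refine Finset.sum_le_sum fun l _ => ?_
  rw [Finset.sum_congr rfl (g := fun _ => f l) (by intro q hq; rw [(Finset.mem_filter.mp hq).2]), Finset.sum_const, nsmul_eq_mul]
  gcongr
  · exact hf l
  · exact rsa_shift (fun x : Fin b → Fin V => rsaMom D (fun i => ((x i : ℕ) : ℤ))) l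

/-- the one variable bilinear sum -/
noncomputable def rsaW (N : ℕ) (γ : ℝ) : ℝ :=
  ∑ μ ∈ Finset.Icc (-(N : ℤ)) N, ‖∑ l ∈ Finset.Icc (-(N : ℤ)) N, rsaE (γ * l * μ)‖

lemma rsa_bilinear (D b V : ℕ) (hb : 1 ≤ b) (γ : Fin D → ℝ) :
    ‖∑ u : Fin V, ∑ v : Fin V, rsaE (∑ j, γ j * (((u : ℕ) : ℝ) * ((v : ℕ) : ℝ)) ^ (j.val + 1))‖ ^ (4 * b ^ 2) ≤
      (V : ℝ) ^ (8 * b ^ 2 - 4 * b) * (rsaJ D b V : ℝ) ^ 2 * ∏ j : Fin D, rsaW (b * V ^ (j.val + 1)) (γ j) := by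
  have hb2 : 2 * b = (2 * b - 1) + 1 := by omega
  set S := ∑ u : Fin V, ∑ v : Fin V, rsaE (∑ j, γ j * (((u : ℕ) : ℝ) * ((v : ℕ) : ℝ)) ^ (j.val + 1)) with hS
  -- step 1
  have h1 : ‖S‖ ^ (2 * b) ≤ (V : ℝ) ^ (2 * b - 1) * ∑ u : Fin V, ‖rsaH D V (fun j => γ j * ((u : ℕ) : ℝ) ^ (j.val + 1))‖ ^ (2 * b) := by
    have e : ∀ u : Fin V, ∑ v : Fin V, rsaE (∑ j, γ j * (((u : ℕ) : ℝ) * ((v : ℕ) : ℝ)) ^ (j.val + 1)) =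
        rsaH D V (fun j => γ j * ((u : ℕ) : ℝ) ^ (j.val + 1)) := by
      intro u
      simp only [rsaH, mul_pow, mul_assoc]
    calc ‖S‖ ^ (2 * b) ≤ (∑ u : Fin V, ‖rsaH D V (fun j => γ j * ((u : ℕ) : ℝ) ^ (j.val + 1))‖) ^ (2 * b) := by
          gcongr
          rw [hS, Finset.sum_congr rfl fun u _ => e u]
          exact norm_sum_le _ _
      _ ≤ _ := by
        have := pow_sum_le_card_mul_sum_pow (s := (Finset.univ : Finset (Fin V))) (f := fun u : Fin V => ‖rsaH D V (fun j => γ j * ((u : ℕ) : ℝ) ^ (j.val + 1))‖) (fun _ _ => norm_nonneg _) (2 * b - 1)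
        rw [← hb2] at this
        simpa using this
  have h2 : ∑ u : Fin V, ‖rsaH D V (fun j => γ j * ((u : ℕ) : ℝ) ^ (j.val + 1))‖ ^ (2 * b) ≤
      ∑ q, ‖rsaH D V (fun j => γ j * (rsaDel D b V q j : ℝ))‖ := by
    have e : ((∑ u : Fin V, ‖rsaH D V (fun j => γ j * ((u : ℕ) : ℝ) ^ (j.val + 1))‖ ^ (2 * b) : ℝ) : ℂ) =
        ∑ q, rsaH D V (fun j => γ j * (rsaDel D b V q j : ℝ)) := by
      rw [Complex.ofReal_sum]
      simp_rw [rsaH_pow]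
      rw [Finset.sum_comm]
      simp only [rsaH]
      refine Finset.sum_congr rfl fun q _ => Finset.sum_congr rfl fun u _ => ?_
      congr 1
      refine Finset.sum_congr rfl fun j _ => by ring
    have e2 := congrArg norm e
    rw [Complex.norm_real, Real.norm_of_nonneg (Finset.sum_nonneg fun _ _ => by positivity)] at e2
    rw [e2]
    exact norm_sum_le _ _
  have h3 : (∑ q, ‖rsaH D V (fun j => γ j * (rsaDel D b V q j : ℝ))‖) ^ (2 * b) ≤
      ((V : ℝ) ^ (2 * b)) ^ (2 * b - 1) * ∑ q, ‖rsaH D V (fun j => γ j * (rsaDel D b V q j : ℝ))‖ ^ (2 * b) := by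
    have := pow_sum_le_card_mul_sum_pow (s := (Finset.univ : Finset ((Fin b → Fin V) × (Fin b → Fin V)))) (f := fun q => ‖rsaH D V (fun j => γ j * (rsaDel D b V q j : ℝ))‖) (fun _ _ => norm_nonneg _) (2 * b - 1)
    rw [← hb2] at this
    refine this.trans (le_of_eq ?_)
    congr 2
    simp [two_mul, pow_add]
  have h4 := rsa_fiber D b V (fun l => ‖rsaH D V (fun j => γ j * (l j : ℝ))‖ ^ (2 * b)) (fun _ => by positivity)
  have h5 : ∑ l ∈ rsaBox D b V, ‖rsaH D V (fun j => γ j * (l j : ℝ))‖ ^ (2 * b) ≤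
      ∑ q, ‖∑ l ∈ rsaBox D b V, rsaE (∑ j, γ j * (l j : ℝ) * (rsaDel D b V q j : ℝ))‖ := by
    have e : ((∑ l ∈ rsaBox D b V, ‖rsaH D V (fun j => γ j * (l j : ℝ))‖ ^ (2 * b) : ℝ) : ℂ) =
        ∑ q, ∑ l ∈ rsaBox D b V, rsaE (∑ j, γ j * (l j : ℝ) * (rsaDel D b V q j : ℝ)) := by
      rw [Complex.ofReal_sum]
      simp_rw [rsaH_pow]
      rw [Finset.sum_comm]
    have e2 := congrArg norm e
    rw [Complex.norm_real, Real.norm_of_nonneg (Finset.sum_nonneg fun _ _ => by positivity)] at e2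
    rw [e2]
    exact norm_sum_le _ _
  have h6 := rsa_fiber D b V (fun m => ‖∑ l ∈ rsaBox D b V, rsaE (∑ j, γ j * (l j : ℝ) * (m j : ℝ))‖) (fun _ => by positivity)
  have h7 : ∑ m ∈ rsaBox D b V, ‖∑ l ∈ rsaBox D b V, rsaE (∑ j, γ j * (l j : ℝ) * (m j : ℝ))‖ =
      ∏ j : Fin D, rsaW (b * V ^ (j.val + 1)) (γ j) := by
    simp only [rsaW, rsaBox]
    rw [Finset.prod_univ_sum]
    refine Finset.sum_congr rfl fun m _ => ?_
    rw [← norm_prod, Finset.prod_univ_sum]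
    congr 1
    refine Finset.sum_congr rfl fun l _ => ?_
    rw [rsaE_sum]
  rw [h7] at h6
  have hJ : (0:ℝ) ≤ rsaJ D b V := by positivity
  calc ‖S‖ ^ (4 * b ^ 2) = (‖S‖ ^ (2 * b)) ^ (2 * b) := by rw [← pow_mul]; congr 1; ring
    _ ≤ ((V : ℝ) ^ (2 * b - 1) * ∑ q, ‖rsaH D V (fun j => γ j * (rsaDel D b V q j : ℝ))‖) ^ (2 * b) := by
      gcongr
      exact h1.trans (by gcongr)
    _ = ((V : ℝ) ^ (2 * b - 1)) ^ (2 * b) * (∑ q, ‖rsaH D V (fun j => γ j * (rsaDel D b V q j : ℝ))‖) ^ (2 * b) := mul_pow _ _ _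
    _ ≤ ((V : ℝ) ^ (2 * b - 1)) ^ (2 * b) * (((V : ℝ) ^ (2 * b)) ^ (2 * b - 1) * (rsaJ D b V * (rsaJ D b V * ∏ j : Fin D, rsaW (b * V ^ (j.val + 1)) (γ j)))) := by
      gcongr
      refine h3.trans ?_
      gcongr
      refine h4.trans ?_
      gcongr
      exact h5.trans h6
    _ = _ := by
      rw [← pow_mul, ← pow_mul]
      have : 8 * b ^ 2 - 4 * b = (2 * b - 1) * (2 * b) + 2 * b * (2 * b - 1) := by
        obtain ⟨c, rfl⟩ := Nat.exists_eq_add_of_le' hb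
        have : 2 * (c + 1) - 1 = 2 * c + 1 := by omega
        rw [this, Nat.sub_eq_iff_eq_add (by nlinarith)]; ring
      rw [this, pow_add]; ring

lemma rsaE_zmod (Q : ℕ) [NeZero Q] (m : ℤ) : rsaE ((m : ℝ) / Q) = ZMod.stdAddChar (m : ZMod Q) := by
  rw [ZMod.stdAddChar_coe, rsaE]; congr 1; push_cast; ring

lemma rsa_fibcount (Q : ℕ) [NeZero Q] (N : ℕ) (r : ZMod Q) :
    (((Finset.Icc (-(N : ℤ)) N).filter fun x : ℤ => (x : ZMod Q) = r).card : ℝ) ≤ (2 * N + 1) / Q + 1 := by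
  have hQ : 0 < Q := Nat.pos_of_ne_zero (NeZero.ne Q)
  have h := Int.Ioc_filter_modEq_card (-(N : ℤ) - 1) N (r := Q) (by exact_mod_cast hQ) (r.val : ℤ)
  have e : (Finset.Icc (-(N : ℤ)) N).filter (fun x : ℤ => (x : ZMod Q) = r) =
      (Finset.Ioc (-(N : ℤ) - 1) N).filter (fun x : ℤ => x ≡ (r.val : ℤ) [ZMOD Q]) := by
    ext x
    simp only [Finset.mem_filter, Finset.mem_Icc, Finset.mem_Ioc]
    rw [← ZMod.intCast_eq_intCast_iff]
    simp
  rw [e]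
  have h' : (((((Finset.Ioc (-(N : ℤ) - 1) N).filter (fun x : ℤ => x ≡ (r.val : ℤ) [ZMOD Q])).card : ℤ) : ℚ)) ≤ (2 * N + 1) / Q + 1 := by
    rw [h]
    push_cast
    apply max_le
    · have h1 := Int.floor_le ((((N : ℤ) : ℚ) - (((r.val : ℕ) : ℤ) : ℚ)) / (((Q : ℕ) : ℤ) : ℚ))
      have h2 := Int.lt_floor_add_one ((((-(N : ℤ) - 1 : ℤ)) : ℚ) - (((r.val : ℕ) : ℤ) : ℚ)) 
      have h3 := Int.lt_floor_add_one (((((-(N : ℤ) - 1 : ℤ)) : ℚ) - (((r.val : ℕ) : ℤ) : ℚ)) / (((Q : ℕ) : ℤ) : ℚ))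
      push_cast at h1 h3 ⊢
      have h4 : ((N : ℚ) - r.val) / Q - ((-(N : ℚ) - 1) - r.val) / Q = (2 * N + 1) / Q := by ring
      linarith
    · positivity
  have h2 := (Rat.cast_le (K := ℝ)).mpr h'
  push_cast at h2
  exact h2

lemma rsa_W_triv (N : ℕ) (γ : ℝ) : rsaW N γ ^ 2 ≤ (2 * N + 1 : ℝ) ^ 4 := by
  have hc : ((Finset.Icc (-(N : ℤ)) N).card : ℝ) = 2 * N + 1 := by
    rw [Int.card_Icc]
    have : ((N : ℤ) + 1 - -N).toNat = 2 * N + 1 := by omega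
    rw [this]; push_cast; ring
  have : rsaW N γ ≤ (2 * N + 1 : ℝ) * (2 * N + 1) := by
    rw [rsaW]
    calc _ ≤ ∑ μ ∈ Finset.Icc (-(N : ℤ)) N, (2 * N + 1 : ℝ) := by
          refine Finset.sum_le_sum fun μ _ => (norm_sum_le _ _).trans ?_
          simp only [rsaE_norm, Finset.sum_const, nsmul_eq_mul, mul_one, hc, le_refl]
      _ = _ := by rw [Finset.sum_const, nsmul_eq_mul, hc]
  have h0 : 0 ≤ rsaW N γ := Finset.sum_nonneg fun _ _ => norm_nonneg _
  nlinarith [pow_le_pow_left₀ h0 this 2]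

lemma rsa_W_good (N Q : ℕ) (hQ : 0 < Q) (c : ℤ) (hc : IsCoprime c Q) (hQN : Q ≤ 2 * N + 1) :
    rsaW N ((c : ℝ) / Q) ^ 2 ≤ 4 * (2 * N + 1 : ℝ) ^ 4 / Q := by
  have : NeZero Q := ⟨hQ.ne'⟩
  have hcard : ((Finset.Icc (-(N : ℤ)) N).card : ℝ) = 2 * N + 1 := by
    rw [Int.card_Icc]
    have : ((N : ℤ) + 1 - -N).toNat = 2 * N + 1 := by omega
    rw [this]; push_cast; ring
  set I := Finset.Icc (-(N : ℤ)) N with hI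
  set B : ℝ := (2 * N + 1) / Q + 1 with hB
  have hQr : (0:ℝ) < Q := by exact_mod_cast hQ
  have hB2 : B ≤ 2 * (2 * N + 1) / Q := by
    have : (1 : ℝ) ≤ (2 * N + 1) / Q := by
      rw [le_div_iff₀ hQr, one_mul]; exact_mod_cast hQN
    rw [hB, mul_div_assoc]; linarith
  have hB0 : 0 ≤ B := by positivity
  let ψ : AddChar (ZMod Q) ℂ := ZMod.stdAddChar
  have hψ : ψ.IsPrimitive := ZMod.isPrimitive_stdAddChar Q
  let f : ZMod Q → ℝ := fun r => ‖∑ l ∈ I, ψ (r * ((c : ZMod Q) * (l : ZMod Q)))‖ ^ 2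
  have hcs : rsaW N ((c : ℝ) / Q) ^ 2 ≤ (2 * N + 1) * ∑ μ ∈ I, f (μ : ZMod Q) := by
    rw [rsaW, ← hcard]
    have := sq_sum_le_card_mul_sum_sq (s := I) (f := fun μ : ℤ => ‖∑ l ∈ I, rsaE ((c : ℝ) / Q * l * μ)‖)
    refine this.trans (le_of_eq ?_)
    congr 1
    refine Finset.sum_congr rfl fun μ _ => ?_
    simp only [f]
    congr 2
    refine Finset.sum_congr rfl fun l _ => ?_
    rw [show (c : ℝ) / Q * l * μ = ((μ * (c * l) : ℤ) : ℝ) / Q by push_cast; ring, rsaE_zmod]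
    push_cast; rfl
  have hfib : ∑ μ ∈ I, f (μ : ZMod Q) ≤ B * ∑ r, f r := by
    rw [← Finset.sum_fiberwise (s := I) (g := fun μ : ℤ => (μ : ZMod Q)), Finset.mul_sum]
    refine Finset.sum_le_sum fun r _ => ?_
    rw [Finset.sum_congr rfl (g := fun _ => f r) (by intro q hq; rw [(Finset.mem_filter.mp hq).2]), Finset.sum_const, nsmul_eq_mul]
    gcongr
    exact rsa_fibcount Q N r
  have hf : ∑ r, f r ≤ Q * (2 * N + 1) * B := by
    have hcz : IsUnit (c : ZMod Q) := by
      rw [ZMod.coe_int_isUnit_iff_isCoprime]; exact hc.symm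
    have key : ((∑ r, f r : ℝ) : ℂ) = ∑ l ∈ I, ∑ l' ∈ I, if (l' : ZMod Q) = l then (Q : ℂ) else 0 := by
      simp only [f]
      push_cast
      simp_rw [← Complex.mul_conj', map_sum, Finset.sum_mul_sum]
      rw [Finset.sum_comm]
      refine Finset.sum_congr rfl fun l _ => ?_
      rw [Finset.sum_comm]
      refine Finset.sum_congr rfl fun l' _ => ?_
      have : ∀ r : ZMod Q, ψ (r * (c * l)) * (starRingEnd ℂ) (ψ (r * (c * l'))) = ψ (r * (c * l - c * l')) := by
        intro r
        rw [mul_sub, sub_eq_add_neg, AddChar.map_add_eq_mul, AddChar.map_neg_eq_conj]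
      rw [Finset.sum_congr rfl fun r _ => this r, AddChar.sum_mulShift _ hψ, ZMod.card]
      have h2 : ((c : ZMod Q) * l - c * l' = 0) ↔ (l' : ZMod Q) = l := by
        rw [← mul_sub, hcz.mul_right_eq_zero, sub_eq_zero, eq_comm]
      simp only [h2]
      split_ifs <;> simp
    have key2 : ∑ r, f r = ∑ l ∈ I, ∑ l' ∈ I, if (l' : ZMod Q) = (l : ZMod Q) then (Q : ℝ) else 0 := by
      apply Complex.ofReal_injective
      rw [key]; push_cast
      refine Finset.sum_congr rfl fun l _ => Finset.sum_congr rfl fun l' _ => by split_ifs <;> simp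
    rw [key2]
    calc _ ≤ ∑ l ∈ I, Q * B := by
          refine Finset.sum_le_sum fun l _ => ?_
          rw [← Finset.sum_filter, Finset.sum_const, nsmul_eq_mul, mul_comm]
          gcongr
          exact rsa_fibcount Q N _
      _ = _ := by rw [Finset.sum_const, nsmul_eq_mul, hcard]; ring
  calc _ ≤ (2 * N + 1 : ℝ) * (B * (Q * (2 * N + 1) * B)) := hcs.trans (by gcongr; exact hfib.trans (by gcongr))
    _ = (2 * N + 1 : ℝ) ^ 2 * Q * B ^ 2 := by ring
    _ ≤ (2 * N + 1 : ℝ) ^ 2 * Q * (2 * (2 * N + 1) / Q) ^ 2 := by gcongr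
    _ = _ := by field_simp; ring

/-- two-adic logarithm surrogate -/
def rsaEll (n : ℕ) (z : ℤ) : ℤ := (z ^ 2 ^ n - 1) / 2 ^ n

lemma rsa_sq_diff (n : ℕ) {x y : ℤ} (hx : Odd x) (hy : Odd y) (h : (4 : ℤ) ∣ x - y) :
    ∃ u : ℤ, Odd u ∧ x ^ 2 ^ n - y ^ 2 ^ n = 2 ^ n * u * (x - y) := by
  induction n generalizing x y with
  | zero => exact ⟨1, odd_one, by simp⟩
  | succ n ih =>
    have h4 : (4 : ℤ) ∣ x ^ 2 - y ^ 2 := by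
      have : x ^ 2 - y ^ 2 = (x - y) * (x + y) := by ring
      rw [this]; exact h.mul_right _
    obtain ⟨u, hu, he⟩ := ih (hx.pow (n := 2)) (hy.pow (n := 2)) h4
    obtain ⟨m, hm⟩ := h
    obtain ⟨y', hy'⟩ := hy
    refine ⟨u * (y + 2 * m), hu.mul (by rw [hy']; exact ⟨y' + m, by ring⟩), ?_⟩
    have e : x + y = 2 * (y + 2 * m) := by linarith
    rw [pow_succ' 2 n, pow_mul, pow_mul, he, pow_succ (2:ℤ) n]
    have : x ^ 2 - y ^ 2 = (x - y) * (x + y) := by ring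
    rw [this, e]; ring

lemma rsa_ell_dvd (n : ℕ) {z : ℤ} (hz : Odd z) (hn : 1 ≤ n) : (2 : ℤ) ^ n * 4 ∣ z ^ 2 ^ n - 1 := by
  obtain ⟨m, rfl⟩ := Nat.exists_eq_add_of_le' hn
  have h8 : (8 : ℤ) ∣ z ^ 2 - 1 := Int.eight_dvd_sq_sub_one_of_odd hz
  obtain ⟨u, hu, he⟩ := rsa_sq_diff m (x := z ^ 2) (y := 1) hz.pow odd_one (by omega)
  rw [pow_succ' (2 : ℕ) m, pow_mul]
  rw [one_pow] at he
  rw [he, pow_succ]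
  obtain ⟨t, ht⟩ := h8
  rw [ht]
  exact ⟨u * t, by ring⟩

lemma rsa_ell_eq (n : ℕ) {z : ℤ} (hz : Odd z) (hn : 1 ≤ n) : (2 : ℤ) ^ n * rsaEll n z = z ^ 2 ^ n - 1 :=
  Int.mul_ediv_cancel' ((Dvd.intro _ rfl).trans (rsa_ell_dvd n hz hn))

lemma rsa_ell_four (n : ℕ) {z : ℤ} (hz : Odd z) (hn : 1 ≤ n) : (4 : ℤ) ∣ rsaEll n z := by
  have h := rsa_ell_dvd n hz hn
  rw [← rsa_ell_eq n hz hn] at h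
  exact Int.dvd_of_mul_dvd_mul_left (by positivity) h

lemma rsa_ell_mul (n : ℕ) {x y : ℤ} (hx : Odd x) (hy : Odd y) (hn : 1 ≤ n) :
    rsaEll n (x * y) = rsaEll n x + rsaEll n y + 2 ^ n * (rsaEll n x * rsaEll n y) := by
  have h1 := rsa_ell_eq n hx hn
  have h2 := rsa_ell_eq n hy hn
  have h3 := rsa_ell_eq n (hx.mul hy) hn
  have hp : (2 : ℤ) ^ n ≠ 0 := by positivity
  apply mul_left_cancel₀ hp
  rw [h3, mul_pow, show x ^ 2 ^ n = 1 + 2 ^ n * rsaEll n x by linarith, show y ^ 2 ^ n = 1 + 2 ^ n * rsaEll n y by linarith]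
  ring

lemma rsa_ell_sub (n : ℕ) {x y : ℤ} (hx : Odd x) (hy : Odd y) (hn : 1 ≤ n) (h : (4 : ℤ) ∣ x - y) :
    ∃ u : ℤ, Odd u ∧ rsaEll n x - rsaEll n y = u * (x - y) := by
  obtain ⟨u, hu, he⟩ := rsa_sq_diff n hx hy h
  refine ⟨u, hu, ?_⟩
  have hp : (2 : ℤ) ^ n ≠ 0 := by positivity
  apply mul_left_cancel₀ hp
  rw [mul_sub, rsa_ell_eq n hx hn, rsa_ell_eq n hy hn]
  linarith

lemma rsa_ell_inj (n : ℕ) {x y : ℤ} (hx : Odd x) (hy : Odd y) (hn : 1 ≤ n) (h : (4 : ℤ) ∣ x - y)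
    (h2 : (2 : ℤ) ^ n ∣ rsaEll n x - rsaEll n y) : (2 : ℤ) ^ n ∣ x - y := by
  obtain ⟨u, hu, he⟩ := rsa_ell_sub n hx hy hn h
  rw [he] at h2
  refine IsCoprime.dvd_of_dvd_mul_left ?_ h2
  exact (Int.isCoprime_two_left.mpr hu).pow_left

/-- two-adic valuation -/
def rsaV (j : ℕ) : ℕ := j.factorization 2

lemma rsaV_le (j : ℕ) (hj : 1 ≤ j) : 2 ^ rsaV j ≤ j := Nat.ordProj_le 2 (by omega)

/-- odd part of the binomial coefficient -/
def rsaO (n j : ℕ) : ℕ := ((2 ^ n).choose j) / 2 ^ ((2 ^ n).choose j).factorization 2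

lemma rsaO_odd (n j : ℕ) (hj : j ≤ 2 ^ n) : Odd (rsaO n j) := by
  rw [← Nat.not_even_iff_odd, even_iff_two_dvd]
  exact Nat.not_dvd_ordCompl Nat.prime_two (Nat.choose_pos hj).ne'

lemma rsa_choose (n j : ℕ) (hj : 1 ≤ j) (hjn : j ≤ 2 ^ n) :
    (2 ^ n).choose j * 2 ^ rsaV j = 2 ^ n * rsaO n j := by
  have h1 : ((2 ^ n).choose j).factorization 2 = n - rsaV j :=
    Nat.factorization_choose_prime_pow Nat.prime_two hjn (by omega)
  have hv : rsaV j ≤ n := (Nat.pow_le_pow_iff_right (by norm_num)).mp ((rsaV_le j hj).trans hjn)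
  have h2 := Nat.ordProj_mul_ordCompl_eq_self ((2 ^ n).choose j) 2
  change 2 ^ ((2 ^ n).choose j).factorization 2 * rsaO n j = _ at h2
  rw [h1] at h2
  rw [← h2]
  calc _ = (2 ^ (n - rsaV j) * 2 ^ rsaV j) * rsaO n j := by ring
    _ = _ := by rw [← pow_add, Nat.sub_add_cancel hv]

lemma rsa_ell_expand (n a : ℕ) (ha : 1 ≤ a) (hn : 1 ≤ n) (Y : ℤ) :
    rsaEll n (1 + 2 ^ a * Y) = ∑ j ∈ Finset.range (2 ^ n),
      (rsaO n (j + 1) : ℤ) * 2 ^ (a * (j + 1) - rsaV (j + 1)) * Y ^ (j + 1) := by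
  have hodd : Odd (1 + 2 ^ a * Y) := by
    obtain ⟨b, rfl⟩ := Nat.exists_eq_add_of_le' ha
    exact ⟨2 ^ b * Y, by ring⟩
  have hp : (2 : ℤ) ^ n ≠ 0 := by positivity
  apply mul_left_cancel₀ hp
  rw [rsa_ell_eq n hodd hn, add_comm, add_pow, Finset.sum_range_succ', Finset.mul_sum]
  simp only [one_pow, mul_one, pow_zero, Nat.choose_zero_right, Nat.cast_one, add_sub_cancel_right]
  refine Finset.sum_congr rfl fun j hj => ?_
  have hj' := Finset.mem_range.mp hj
  have h := rsa_choose n (j + 1) (by omega) (by omega)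
  have hv : rsaV (j + 1) ≤ a * (j + 1) := by
    have h1 := rsaV_le (j + 1) (by omega)
    have h2 : rsaV (j + 1) < j + 1 := (Nat.lt_two_pow_self).trans_le h1
    nlinarith
  have h' : (((2 ^ n).choose (j + 1) : ℕ) : ℤ) * 2 ^ rsaV (j + 1) = 2 ^ n * (rsaO n (j + 1) : ℤ) := by exact_mod_cast h
  have e : (2 : ℤ) ^ (a * (j + 1)) = 2 ^ (a * (j + 1) - rsaV (j + 1)) * 2 ^ rsaV (j + 1) := by
    rw [← pow_add, Nat.sub_add_cancel hv]
  rw [mul_pow, ← pow_mul, e]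
  linear_combination 2 ^ (a * (j + 1) - rsaV (j + 1)) * Y ^ (j + 1) * h'

lemma rsa_ell_trunc (n a k D : ℕ) (ha : 1 ≤ a) (hn : 1 ≤ n) (hk : k ≤ a * D) (hD : D + 1 ≤ 2 ^ a) (hDn : D ≤ 2 ^ n) (Y : ℤ) :
    (2 : ℤ) ^ k ∣ rsaEll n (1 + 2 ^ a * Y) - ∑ j : Fin D,
      (rsaO n (j.val + 1) : ℤ) * 2 ^ (a * (j.val + 1) - rsaV (j.val + 1)) * Y ^ (j.val + 1) := by
  rw [rsa_ell_expand n a ha hn, ← Finset.sum_range_add_sum_Ico _ hDn, Finset.sum_range, add_sub_cancel_left]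
  refine Finset.dvd_sum fun j hj => ?_
  refine Dvd.dvd.mul_right (Dvd.dvd.mul_left ?_ _) _
  apply pow_dvd_pow
  obtain ⟨h1, h2⟩ := Finset.mem_Ico.mp hj
  obtain ⟨i, rfl⟩ := Nat.exists_eq_add_of_le h1
  have h3 : 2 ^ rsaV (D + i + 1) ≤ 2 ^ (a * (i + 1)) := by
    refine (rsaV_le _ (by omega)).trans ?_
    calc D + i + 1 ≤ (D + 1) * (i + 1) := by nlinarith
      _ ≤ 2 ^ a * 2 ^ i := Nat.mul_le_mul hD (Nat.lt_two_pow_self)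
      _ ≤ 2 ^ a * 2 ^ (a * i) := by
        gcongr
        · norm_num
        · nlinarith
      _ = _ := by rw [← pow_add]; congr 1; ring
  have h4 := (Nat.pow_le_pow_iff_right (by norm_num)).mp h3
  have : a * (D + i + 1) = a * D + a * (i + 1) := by ring
  omega

lemma rsa_prodA (A V : ℝ) (D : ℕ) :
    ∏ j ∈ Finset.range D, (A * V ^ (j + 1)) ^ 4 = A ^ (4 * D) * V ^ (2 * D * (D + 1)) := by
  induction D with
  | zero => simp
  | succ D ih => rw [Finset.prod_range_succ, ih]; ring

lemma rsa_exparith (d g L : ℕ) (hd : 600 ≤ d) (hL : 1 ≤ L) (hg : 1000000 * d * L ≤ g) :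
    24778656 * d ^ 3 * L + 96 * d * L + 2 * d + (g + 1) * (432 * d ^ 3 + 60048 * d ^ 2) +
      (2 * L + 2) * (8 * (4320 * d ^ 2) ^ 2) + 4320 * d ^ 3 ≤ 1440 * d ^ 3 * g := by
  have h1 : 600 * (d * d) ≤ d * d * d := by nlinarith
  have hL' : 1 * d ≤ d * L := by nlinarith
  have hdL : 600 * L ≤ d * L := by nlinarith
  have hdg : 600000000 ≤ g := by nlinarith
  have e1 : 24778656 * d ^ 3 * L ≤ d ^ 3 * g := by
    have : 24778656 * L ≤ g := by nlinarith
    calc _ = d ^ 3 * (24778656 * L) := by ring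
      _ ≤ _ := by gcongr
  have e2 : 96 * d * L + 2 * d ≤ d ^ 3 * g := by
    have : 96 * d * L + 2 * d ≤ 1 * g := by nlinarith
    refine this.trans ?_
    gcongr
    exact Nat.one_le_pow _ _ (by omega)
  have e3 : (g + 1) * (432 * d ^ 3 + 60048 * d ^ 2) ≤ 534 * d ^ 3 * g := by
    have : 432 * d ^ 3 + 60048 * d ^ 2 ≤ 533 * d ^ 3 := by nlinarith
    calc _ ≤ (g + 1) * (533 * d ^ 3) := by gcongr
      _ = (533 * g + 533) * d ^ 3 := by ring
      _ ≤ (534 * g) * d ^ 3 := by gcongr; omega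
      _ = _ := by ring
  have e4 : (2 * L + 2) * (8 * (4320 * d ^ 2) ^ 2) ≤ 600 * d ^ 3 * g := by
    calc (2 * L + 2) * (8 * (4320 * d ^ 2) ^ 2) ≤ (4 * L) * (8 * (4320 * d ^ 2) ^ 2) := by gcongr; omega
      _ = d ^ 3 * (597196800 * (d * L)) := by ring
      _ ≤ d ^ 3 * (600 * g) := Nat.mul_le_mul_left _ (by nlinarith)
      _ = _ := by ring
  have e5 : 4320 * d ^ 3 ≤ d ^ 3 * g := by
    calc _ = d ^ 3 * 4320 := by ring
      _ ≤ _ := by gcongr; omega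
  nlinarith

lemma rsa_numeric {p d g L : ℕ} (hp : p.Prime) (hpg : 2 ^ g < p) (hpg2 : p ≤ 2 ^ (g + 1)) (hd : 600 ≤ d) (hL : 1 ≤ L)
    (hdL : 12 * d ≤ 2 ^ L) (hg : 1000000 * d * L ≤ g) (γ : Fin (6 * d) → ℝ)
    (hgood : ∀ j : Fin (6 * d), 3 * d ≤ j.val + 1 → j.val + 1 < 4 * d → ∃ (c : ℤ) (q : ℕ), Odd c ∧
      γ j = (c : ℝ) / ((2 ^ q : ℕ) : ℝ) ∧ 2 ^ q ≤ 2 * (4320 * d ^ 2 * (p ^ (720 * d)) ^ (j.val + 1)) + 1 ∧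
      1440 * d ^ 2 * g ≤ q + 4320 * d ^ 2) :
    ‖∑ u : Fin (p ^ (720 * d)), ∑ v : Fin (p ^ (720 * d)), rsaE (∑ j, γ j * (((u : ℕ) : ℝ) * ((v : ℕ) : ℝ)) ^ (j.val + 1))‖ *
      2 ^ (2 * L + 2) ≤ ((p : ℝ) ^ (720 * d)) ^ 2 := by
  have hbil := rsa_bilinear (6 * d) (4320 * d ^ 2) (p ^ (720 * d)) (by nlinarith) γ
  set X := ‖∑ u : Fin (p ^ (720 * d)), ∑ v : Fin (p ^ (720 * d)), rsaE (∑ j, γ j * (((u : ℕ) : ℝ) * ((v : ℕ) : ℝ)) ^ (j.val + 1))‖ with hX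
  set b := 4320 * d ^ 2 with hb
  clear_value b
  have hb1 : 1 ≤ b := by nlinarith
  have hJ := rsa_vmvt hp (d := d) (by omega) (by
      have : L ≤ g := by nlinarith
      have := Nat.pow_le_pow_right (show 0 < 2 by norm_num) this
      omega) (714 * d) (by omega)
  rw [show (6 * d) ^ 2 + 714 * d * (6 * d) = b by rw [hb]; ring, show 6 * d + 714 * d = 720 * d by ring] at hJ
  set J := rsaJ (6 * d) b (p ^ (720 * d)) with hJd
  have hp0 : (0 : ℝ) < p := by exact_mod_cast hp.pos
  have hp1 : (1 : ℝ) ≤ p := by exact_mod_cast hp.one_lt.le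
  set V : ℝ := (p : ℝ) ^ (720 * d) with hV
  push_cast at hbil
  rw [← hV] at hbil
  clear_value V
  have hV1 : 1 ≤ V := hV ▸ one_le_pow₀ hp1
  have hV0 : 0 < V := by positivity
  have hJr : (J : ℝ) * (p : ℝ) ^ (12852 * d ^ 3) ≤ (12 * d : ℝ) ^ (6194664 * d ^ 3) * V ^ (2 * b) * (p : ℝ) ^ (12852 * d ^ 2) := by
    have : (J : ℝ) * (p : ℝ) ^ (18 * d ^ 2 * (714 * d)) ≤ ((12 * d : ℝ) ^ (241 * (6 * d) ^ 2)) ^ (714 * d) * (p : ℝ) ^ (2 * b * (720 * d) + 3 * (6 * d) * (714 * d)) := by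
      exact_mod_cast hJ
    rw [hV, ← pow_mul (p : ℝ), mul_assoc, ← pow_add]
    rw [← pow_mul] at this
    convert this using 3 <;> ring
  have hJ4 : (J : ℝ) ^ 4 * (p : ℝ) ^ (51408 * d ^ 3) ≤ (12 * d : ℝ) ^ (24778656 * d ^ 3) * V ^ (8 * b) * (p : ℝ) ^ (51408 * d ^ 2) := by
    have := pow_le_pow_left₀ (by positivity) hJr 4
    have key : ∀ (x y z : ℝ) (i j k i' j' k' : ℕ), i' = i * 4 → j' = j * 4 → k' = k * 4 →
        (x ^ i * y ^ j * z ^ k) ^ 4 = x ^ i' * y ^ j' * z ^ k' := by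
      rintro x y z i j k _ _ _ rfl rfl rfl
      ring
    rw [key _ _ _ _ _ _ (24778656 * d ^ 3) (8 * b) (51408 * d ^ 2) (by ring) (by ring) (by ring)] at this
    refine le_trans (le_of_eq ?_) this
    rw [mul_pow, ← pow_mul]
    congr 2; ring
  -- product
  obtain ⟨E, hE⟩ : ∃ E, E = 1440 * d ^ 2 * g - 4320 * d ^ 2 := ⟨_, rfl⟩
  have hgd : 3 ≤ g := by nlinarith
  have hEd : E * d + 4320 * d ^ 3 = 1440 * d ^ 3 * g := by
    have : E + 4320 * d ^ 2 = 1440 * d ^ 2 * g := by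
      rw [hE]; apply Nat.sub_add_cancel; nlinarith
    calc E * d + 4320 * d ^ 3 = (E + 4320 * d ^ 2) * d := by ring
      _ = _ := by rw [this]; ring
  have hW : ∏ j : Fin (6 * d), rsaW (b * (p ^ (720 * d)) ^ (j.val + 1)) (γ j) ^ 2 ≤
      (3 * b : ℝ) ^ (24 * d) * V ^ (12 * d * (6 * d + 1)) * (4 * (1 / 2) ^ E) ^ d := by
    have h1 : ∀ j : Fin (6 * d), rsaW (b * (p ^ (720 * d)) ^ (j.val + 1)) (γ j) ^ 2 ≤
        (3 * b * V ^ (j.val + 1)) ^ 4 * (if 3 * d ≤ j.val + 1 ∧ j.val + 1 < 4 * d then (4 * (1 / 2) ^ E : ℝ) else 1) := by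
      intro j
      set N := b * (p ^ (720 * d)) ^ (j.val + 1) with hN
      have hNr : (2 * N + 1 : ℝ) ≤ 3 * b * V ^ (j.val + 1) := by
        have : (N : ℝ) = b * V ^ (j.val + 1) := by rw [hN, hV]; push_cast; rfl
        have h2 : (1 : ℝ) ≤ b * V ^ (j.val + 1) := one_le_mul_of_one_le_of_one_le (by exact_mod_cast hb1) (one_le_pow₀ hV1)
        rw [this]; linarith
      split_ifs with hj
      · obtain ⟨c, q, hc, hγ, hq, hqE⟩ := hgood j hj.1 hj.2
        rw [hγ]
        have := rsa_W_good N (2 ^ q) (by positivity) c (by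
          push_cast
          exact ((Int.isCoprime_two_left.mpr hc).pow_left).symm) hq
        refine this.trans ?_
        have h3 : (1 : ℝ) / ((2 ^ q : ℕ) : ℝ) ≤ (1 / 2) ^ E := by
          push_cast
          rw [← one_div_pow]
          apply pow_le_pow_of_le_one (by norm_num) (by norm_num)
          omega
        calc _ = (2 * N + 1 : ℝ) ^ 4 * (4 * (1 / ((2 ^ q : ℕ) : ℝ))) := by ring
          _ ≤ _ := by gcongr
      · rw [mul_one]
        exact (rsa_W_triv N _).trans (by gcongr)
    calc _ ≤ ∏ j : Fin (6 * d), ((3 * b * V ^ (j.val + 1)) ^ 4 * (if 3 * d ≤ j.val + 1 ∧ j.val + 1 < 4 * d then (4 * (1 / 2) ^ E : ℝ) else 1)) :=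
          Finset.prod_le_prod (fun _ _ => by positivity) fun j _ => h1 j
      _ = (∏ j ∈ Finset.range (6 * d), (3 * b * V ^ (j + 1)) ^ 4) * ∏ j ∈ Finset.range (6 * d), (if 3 * d ≤ j + 1 ∧ j + 1 < 4 * d then (4 * (1 / 2) ^ E : ℝ) else 1) := by
        rw [Finset.prod_mul_distrib, Finset.prod_range, Finset.prod_range]
      _ = _ := by
        rw [rsa_prodA, ← Finset.prod_filter, Finset.prod_const]
        have : ((Finset.range (6 * d)).filter fun j => 3 * d ≤ j + 1 ∧ j + 1 < 4 * d) = Finset.Ico (3 * d - 1) (4 * d - 1) := by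
          ext j; simp only [Finset.mem_filter, Finset.mem_range, Finset.mem_Ico]; omega
        rw [this, Nat.card_Ico, show 4 * d - 1 - (3 * d - 1) = d by omega]
        congr 2
        · congr 1; ring
        · congr 1; ring
  have hX2 : X ^ (8 * b ^ 2) ≤ V ^ (16 * b ^ 2 - 8 * b) * (J : ℝ) ^ 4 * ((3 * b : ℝ) ^ (24 * d) * V ^ (12 * d * (6 * d + 1)) * (4 * (1 / 2) ^ E) ^ d) := by
    have := pow_le_pow_left₀ (by positivity) hbil 2
    rw [mul_pow, mul_pow, ← Finset.prod_pow, ← pow_mul, ← pow_mul, ← pow_mul, show (8 * b ^ 2 - 4 * b) * 2 = 16 * b ^ 2 - 8 * b by omega] at this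
    calc _ = X ^ (4 * b ^ 2 * 2) := by congr 1; ring
      _ ≤ _ := this
      _ ≤ _ := by
        gcongr
  have hX3 : X ^ (8 * b ^ 2) * 2 ^ (E * d) ≤ V ^ (16 * b ^ 2) * ((12 * d : ℝ) ^ (24778656 * d ^ 3) * (3 * b : ℝ) ^ (24 * d) * 4 ^ d * (p : ℝ) ^ (432 * d ^ 3 + 60048 * d ^ 2)) := by
    have hpp : (0 : ℝ) < (p : ℝ) ^ (51408 * d ^ 3) := by positivity
    rw [← mul_le_mul_iff_left₀ hpp]
    have hb8 : 8 * b ≤ 16 * b ^ 2 := by nlinarith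
    calc _ ≤ (V ^ (16 * b ^ 2 - 8 * b) * (J : ℝ) ^ 4 * ((3 * b : ℝ) ^ (24 * d) * V ^ (12 * d * (6 * d + 1)) * (4 * (1 / 2) ^ E) ^ d)) * 2 ^ (E * d) * (p : ℝ) ^ (51408 * d ^ 3) := by gcongr
      _ = (V ^ (16 * b ^ 2 - 8 * b) * ((J : ℝ) ^ 4 * (p : ℝ) ^ (51408 * d ^ 3)) * ((3 * b : ℝ) ^ (24 * d) * V ^ (12 * d * (6 * d + 1)) * 4 ^ d)) := by
        have h4 : (4 * (1 / 2 : ℝ) ^ E) ^ d * 2 ^ (E * d) = 4 ^ d := by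
          rw [mul_pow, ← pow_mul, mul_assoc, ← mul_pow]; norm_num
        calc _ = V ^ (16 * b ^ 2 - 8 * b) * ((J : ℝ) ^ 4 * (p : ℝ) ^ (51408 * d ^ 3)) * ((3 * b : ℝ) ^ (24 * d) * V ^ (12 * d * (6 * d + 1)) * ((4 * (1 / 2 : ℝ) ^ E) ^ d * 2 ^ (E * d))) := by ring
          _ = _ := by rw [h4]
      _ ≤ (V ^ (16 * b ^ 2 - 8 * b) * ((12 * d : ℝ) ^ (24778656 * d ^ 3) * V ^ (8 * b) * (p : ℝ) ^ (51408 * d ^ 2)) * ((3 * b : ℝ) ^ (24 * d) * V ^ (12 * d * (6 * d + 1)) * 4 ^ d)) := by gcongr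
      _ = (V ^ (16 * b ^ 2 - 8 * b) * V ^ (8 * b)) * ((12 * d : ℝ) ^ (24778656 * d ^ 3) * (3 * b : ℝ) ^ (24 * d) * 4 ^ d * ((p : ℝ) ^ (51408 * d ^ 2) * V ^ (12 * d * (6 * d + 1)))) := by ring
      _ = _ := by
        have hpV : (p : ℝ) ^ (51408 * d ^ 2) * V ^ (12 * d * (6 * d + 1)) = (p : ℝ) ^ (432 * d ^ 3 + 60048 * d ^ 2) * (p : ℝ) ^ (51408 * d ^ 3) := by
          rw [hV, ← pow_mul, ← pow_add, ← pow_add]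
          congr 1; ring
        rw [← pow_add, Nat.sub_add_cancel hb8, hpV, ← mul_assoc, ← mul_assoc]
        ring
  have hC : ((12 * d : ℝ) ^ (24778656 * d ^ 3) * (3 * b : ℝ) ^ (24 * d) * 4 ^ d * (p : ℝ) ^ (432 * d ^ 3 + 60048 * d ^ 2)) ≤
      2 ^ (24778656 * d ^ 3 * L + 96 * d * L + 2 * d + (g + 1) * (432 * d ^ 3 + 60048 * d ^ 2)) := by
    have h12 : (12 * d : ℝ) ≤ 2 ^ L := by exact_mod_cast hdL
    have h3b : (3 * b : ℝ) ≤ 2 ^ (4 * L) := by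
      have h4 : 3 * b ≤ (12 * d) ^ 4 := by
        rw [hb]
        have : d ^ 2 * 1 ≤ d ^ 2 * d ^ 2 := by gcongr; exact Nat.one_le_pow _ _ (by omega)
        nlinarith
      have h5 : (3 * b : ℝ) ≤ (12 * d : ℝ) ^ 4 := by exact_mod_cast h4
      refine h5.trans ?_
      rw [mul_comm 4 L, pow_mul]
      gcongr
    have hpr : (p : ℝ) ≤ 2 ^ (g + 1) := by exact_mod_cast hpg2
    calc _ ≤ ((2 : ℝ) ^ L) ^ (24778656 * d ^ 3) * (2 ^ (4 * L)) ^ (24 * d) * (2 ^ 2) ^ d * (2 ^ (g + 1)) ^ (432 * d ^ 3 + 60048 * d ^ 2) := by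
          gcongr
          norm_num
      _ = _ := by
        rw [← pow_mul, ← pow_mul, ← pow_mul, ← pow_mul, ← pow_add, ← pow_add, ← pow_add]
        congr 1; ring
  have hfin : (X * 2 ^ (2 * L + 2)) ^ (8 * b ^ 2) ≤ (V ^ 2) ^ (8 * b ^ 2) := by
    have h2E : (0 : ℝ) < 2 ^ (E * d) := by positivity
    rw [← mul_le_mul_iff_left₀ h2E]
    have har := rsa_exparith d g L hd hL hg
    rw [← hb] at har
    calc _ = (X ^ (8 * b ^ 2) * 2 ^ (E * d)) * 2 ^ ((2 * L + 2) * (8 * b ^ 2)) := by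
          rw [mul_pow, ← pow_mul]; ring
      _ ≤ (V ^ (16 * b ^ 2) * 2 ^ (24778656 * d ^ 3 * L + 96 * d * L + 2 * d + (g + 1) * (432 * d ^ 3 + 60048 * d ^ 2))) * 2 ^ ((2 * L + 2) * (8 * b ^ 2)) := by
        refine mul_le_mul_of_nonneg_right ?_ (by positivity)
        exact hX3.trans (mul_le_mul_of_nonneg_left hC (by positivity))
      _ = V ^ (16 * b ^ 2) * 2 ^ (24778656 * d ^ 3 * L + 96 * d * L + 2 * d + (g + 1) * (432 * d ^ 3 + 60048 * d ^ 2) + (2 * L + 2) * (8 * b ^ 2)) := by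
        rw [mul_assoc, ← pow_add]
      _ ≤ V ^ (16 * b ^ 2) * 2 ^ (E * d) := by
        gcongr
        · norm_num
        · omega
      _ = _ := by rw [← pow_mul]; congr 2; ring
  exact le_of_pow_le_pow_left₀ (by positivity) (by positivity) hfin

lemma rsaE_congr (k : ℕ) (c x y : ℤ) (h : (2 : ℤ) ^ k ∣ x - y) :
    rsaE ((c : ℝ) * x / 2 ^ k) = rsaE ((c : ℝ) * y / 2 ^ k) := by
  obtain ⟨m, hm⟩ := h
  have : x = y + 2 ^ k * m := by linarith
  rw [this]
  push_cast
  rw [show (c : ℝ) * (y + 2 ^ k * m) / 2 ^ k = (c : ℝ) * y / 2 ^ k + ((c * m : ℤ) : ℝ) by push_cast; field_simp]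
  exact rsaE_add_int _ _

lemma rsa_phase {n a k D : ℕ} (ha : 2 ≤ a) (hn : 1 ≤ n) (hkn : k ≤ n) (hk : k ≤ a * D) (hD : D + 1 ≤ 2 ^ a) (hDn : D ≤ 2 ^ n)
    {τ w : ℤ} (hτ : Odd τ) (hw : (2 : ℤ) ^ n ∣ 1 - τ * w) (y : ℤ) :
    (2 : ℤ) ^ k ∣ rsaEll n (τ + 2 ^ a * y) - (rsaEll n τ + ∑ j : Fin D,
      (rsaO n (j.val + 1) : ℤ) * 2 ^ (a * (j.val + 1) - rsaV (j.val + 1)) * (w * y) ^ (j.val + 1)) := by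
  have h4 : (4 : ℤ) ∣ 2 ^ a := by
    have := pow_dvd_pow (2 : ℤ) ha
    norm_num at this ⊢; exact this
  have h2 : (2 : ℤ) ∣ 2 ^ a := (by norm_num : (2 : ℤ) ∣ 4).trans h4
  have odd1 : ∀ z t : ℤ, Odd z → Odd (z + 2 ^ a * t) := fun z t hz => hz.add_even ((even_iff_two_dvd.mpr h2).mul_right _)
  have hkd : (2 : ℤ) ^ k ∣ 2 ^ n := pow_dvd_pow _ hkn
  obtain ⟨u, -, hu⟩ := rsa_ell_sub n (x := τ + 2 ^ a * y) (y := τ * (1 + 2 ^ a * (w * y))) (odd1 _ _ hτ) (hτ.mul (odd1 _ _ odd_one)) hn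
    (by
      have : τ + 2 ^ a * y - τ * (1 + 2 ^ a * (w * y)) = 2 ^ a * (y - τ * w * y) := by ring
      rw [this]; exact h4.mul_right _)
  have h1 := rsa_ell_mul n hτ (odd1 1 (w * y) odd_one) hn
  have h3 := rsa_ell_trunc n a k D (by omega) hn hk hD hDn (w * y)
  set Sg := ∑ j : Fin D, (rsaO n (j.val + 1) : ℤ) * 2 ^ (a * (j.val + 1) - rsaV (j.val + 1)) * (w * y) ^ (j.val + 1)
  have e : rsaEll n (τ + 2 ^ a * y) - (rsaEll n τ + Sg) =
      (1 - τ * w) * (u * 2 ^ a * y) + 2 ^ n * (rsaEll n τ * rsaEll n (1 + 2 ^ a * (w * y))) + (rsaEll n (1 + 2 ^ a * (w * y)) - Sg) := by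
    have hu' : rsaEll n (τ + 2 ^ a * y) = rsaEll n (τ * (1 + 2 ^ a * (w * y))) + u * (τ + 2 ^ a * y - τ * (1 + 2 ^ a * (w * y))) := by linarith
    rw [hu', h1]; ring
  rw [e]
  exact dvd_add (dvd_add ((hkd.trans hw).mul_right _) (hkd.mul_right _)) h3

lemma rsa_antiper (f : ℕ → ℂ) (P : ℕ) (hf : ∀ y, f (y + P) = - f y) (M : ℕ) : ∑ y ∈ Finset.range (2 * P * M), f y = 0 := by
  induction M with
  | zero => simp
  | succ M ih =>
    rw [show 2 * P * (M + 1) = 2 * P * M + P + P by ring, Finset.sum_range_add, Finset.sum_range_add, ih, zero_add, ← Finset.sum_add_distrib]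
    refine Finset.sum_eq_zero fun y _ => ?_
    rw [show 2 * P * M + P + y = 2 * P * M + y + P by ring, hf]; ring

lemma rsa_sum_small {n k H : ℕ} (hn : 1 ≤ n) (hk : 3 ≤ k) (hkH : k ≤ H) (c : ℤ) (hc : Odd c) (t0 : ℤ) (ht0 : Odd t0) :
    ∑ y ∈ Finset.range (2 ^ (H - 2)), rsaE ((c : ℝ) * (rsaEll n (t0 + 4 * y) : ℤ) / 2 ^ k) = 0 := by
  have e : 2 ^ (H - 2) = 2 * 2 ^ (k - 3) * 2 ^ (H - k) := by
    rw [← pow_succ', ← pow_add]; congr 1; omega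
  rw [e]
  apply rsa_antiper
  intro y
  have odd1 : ∀ z : ℤ, Odd (t0 + 4 * z) := fun z => ht0.add_even ⟨2 * z, by ring⟩
  obtain ⟨u, hu, he⟩ := rsa_ell_sub n (odd1 ((y + 2 ^ (k - 3) : ℕ) : ℤ)) (odd1 y) hn ⟨2 ^ (k - 3), by push_cast; ring⟩
  have e1 : rsaEll n (t0 + 4 * ((y + 2 ^ (k - 3) : ℕ) : ℤ)) = rsaEll n (t0 + 4 * y) + u * 2 ^ (k - 1) := by
    have : (2 : ℤ) ^ (k - 1) = 4 * 2 ^ (k - 3) := by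
      rw [show k - 1 = (k - 3) + 2 by omega, pow_add]; ring
    rw [this]
    push_cast at he ⊢
    linarith
  rw [e1]
  obtain ⟨m, hm⟩ := hc.mul hu
  have e2 : (c : ℝ) * ((rsaEll n (t0 + 4 * y) + u * 2 ^ (k - 1) : ℤ) : ℝ) / 2 ^ k = (c : ℝ) * (rsaEll n (t0 + 4 * y) : ℤ) / 2 ^ k + 1 / 2 + (m : ℤ) := by
    have h2 : (2 : ℝ) ^ k = 2 * 2 ^ (k - 1) := by rw [← pow_succ']; congr 1; omega
    have h3 : (c : ℝ) * u = 2 * m + 1 := by exact_mod_cast hm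
    push_cast
    rw [h2]
    field_simp
    linear_combination 2 ^ (k - 1) * h3
  rw [e2, rsaE_add_int, rsaE_add]
  have : rsaE (1 / 2) = -1 := by
    rw [rsaE, ← Complex.exp_pi_mul_I]; congr 1; push_cast; ring
  rw [this]; ring

lemma rsa_shiftavg (φ : ℕ → ℂ) (hφ : ∀ x, ‖φ x‖ = 1) (X V : ℕ) (hV : 1 ≤ V) (B : ℝ)
    (hB : ∀ x, ‖∑ u : Fin V, ∑ v : Fin V, φ (x + (u : ℕ) * (v : ℕ))‖ ≤ B * (V : ℝ) ^ 2) :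
    ‖∑ x ∈ Finset.range X, φ x‖ ≤ X * B + 2 * (V : ℝ) ^ 2 := by
  set T := ∑ x ∈ Finset.range X, φ x with hT
  have hV0 : (0 : ℝ) < (V : ℝ) ^ 2 := by positivity
  have h1 : ∀ u v : Fin V, ‖T - ∑ x ∈ Finset.range X, φ (x + (u : ℕ) * (v : ℕ))‖ ≤ 2 * (V : ℝ) ^ 2 := by
    intro u v
    set w := (u : ℕ) * (v : ℕ) with hw
    have h1 : ∑ x ∈ Finset.range w, φ x + ∑ x ∈ Finset.range X, φ (x + w) = T + ∑ x ∈ Finset.range w, φ (X + x) := by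
      rw [hT, ← Finset.sum_range_add, add_comm X w, Finset.sum_range_add]
      simp only [add_comm]
    have h2 : T - ∑ x ∈ Finset.range X, φ (x + w) = ∑ x ∈ Finset.range w, φ x - ∑ x ∈ Finset.range w, φ (X + x) := by
      linear_combination -h1
    have b1 : ‖∑ x ∈ Finset.range w, φ x‖ ≤ w := (norm_sum_le _ _).trans (by simp [hφ])
    have b2 : ‖∑ x ∈ Finset.range w, φ (X + x)‖ ≤ w := (norm_sum_le _ _).trans (by simp [hφ])
    have hw2 : (w : ℝ) ≤ (V : ℝ) ^ 2 := by
      have : w ≤ V ^ 2 := by rw [hw, sq]; exact Nat.mul_le_mul u.2.le v.2.le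
      exact_mod_cast this
    rw [h2]
    refine (norm_sub_le _ _).trans ?_
    linarith
  have h2 : ‖(V : ℂ) ^ 2 * T - ∑ x ∈ Finset.range X, ∑ u : Fin V, ∑ v : Fin V, φ (x + (u : ℕ) * (v : ℕ))‖ ≤ (V : ℝ) ^ 2 * (2 * (V : ℝ) ^ 2) := by
    have e : (V : ℂ) ^ 2 * T - ∑ x ∈ Finset.range X, ∑ u : Fin V, ∑ v : Fin V, φ (x + (u : ℕ) * (v : ℕ)) =
        ∑ u : Fin V, ∑ v : Fin V, (T - ∑ x ∈ Finset.range X, φ (x + (u : ℕ) * (v : ℕ))) := by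
      simp only [Finset.sum_sub_distrib, Finset.sum_const, Finset.card_univ, Fintype.card_fin, nsmul_eq_mul]
      congr 1
      · ring
      · rw [Finset.sum_comm]
        refine Finset.sum_congr rfl fun u _ => ?_
        rw [Finset.sum_comm]
    rw [e]
    calc _ ≤ ∑ u : Fin V, ∑ v : Fin V, 2 * (V : ℝ) ^ 2 :=
          (norm_sum_le _ _).trans (Finset.sum_le_sum fun u _ => (norm_sum_le _ _).trans (Finset.sum_le_sum fun v _ => h1 u v))
      _ = _ := by simp; ring
  have h3 : ‖∑ x ∈ Finset.range X, ∑ u : Fin V, ∑ v : Fin V, φ (x + (u : ℕ) * (v : ℕ))‖ ≤ X * (B * (V : ℝ) ^ 2) := by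
    refine (norm_sum_le _ _).trans ((Finset.sum_le_sum fun x _ => hB x).trans ?_)
    simp
  have h4 : (V : ℝ) ^ 2 * ‖T‖ ≤ (V : ℝ) ^ 2 * (X * B + 2 * (V : ℝ) ^ 2) := by
    have h5 : ‖(V : ℂ) ^ 2 * T‖ = (V : ℝ) ^ 2 * ‖T‖ := by simp
    have h6 := norm_sub_norm_le ((V : ℂ) ^ 2 * T) (∑ x ∈ Finset.range X, ∑ u : Fin V, ∑ v : Fin V, φ (x + (u : ℕ) * (v : ℕ)))
    rw [h5] at h6
    nlinarith
  exact le_of_mul_le_mul_left h4 hV0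

/-- bound for one residue class -/
lemma rsa_class {n k d g L p : ℕ} (hd : 600 ≤ d) (hL : 1 ≤ L) (hdL : 12 * d ≤ 2 ^ L) (hg : 1000000 * d * L ≤ g)
    (hp : p.Prime) (hpg : 2 ^ g < p) (hpg2 : p ≤ 2 ^ (g + 1)) (hkn : k ≤ n) (hdk : 8640 * d ^ 2 ≤ k)
    (hDn : 6 * d ≤ 2 ^ n)
    (hk1 : k ≤ 4320 * d ^ 2 * g) (hk2 : 4320 * d ^ 2 * g ≤ k + 4320 * d ^ 2) (c : ℤ) (hc : Odd c) (τ : ℤ) (hτ : Odd τ) :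
    ‖∑ u : Fin (p ^ (720 * d)), ∑ v : Fin (p ^ (720 * d)),
        rsaE ((c : ℝ) * (rsaEll n (τ + 2 ^ (720 * d * g) * (((u : ℕ) * (v : ℕ) : ℕ) : ℤ)) : ℤ) / 2 ^ k)‖ * 2 ^ (2 * L + 2) ≤
      ((p : ℝ) ^ (720 * d)) ^ 2 := by
  set a := 720 * d * g with ha
  have hLg : L ≤ g := by nlinarith
  have hga : g ≤ a := by nlinarith
  have ha2 : 2 ≤ a := by nlinarith
  have hn1 : 1 ≤ n := by nlinarith
  have hDa : 6 * d + 1 ≤ 2 ^ a := by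
    have := Nat.pow_le_pow_right (show 0 < 2 by norm_num) (hLg.trans hga)
    omega
  have hkaD : k ≤ a * (6 * d) := by rw [ha]; refine hk1.trans (le_of_eq (by ring))
  obtain ⟨w, hw⟩ : ∃ w : ℤ, (2 : ℤ) ^ n ∣ 1 - τ * w := by
    have : IsCoprime τ ((2 : ℤ) ^ n) := ((Int.isCoprime_two_left.mpr hτ).pow_left).symm
    obtain ⟨x, y, hxy⟩ := this
    exact ⟨x, y, by linarith⟩
  have hwo : Odd w := by
    have h2 : (2 : ℤ) ∣ 1 - τ * w := (dvd_pow_self 2 (by omega)).trans hw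
    have : Odd (τ * w) := by
      obtain ⟨m, hm⟩ := h2
      exact ⟨-m, by linarith⟩
    exact (Int.odd_mul.mp this).2
  set γ : Fin (6 * d) → ℝ := fun j => (c : ℝ) * ((rsaO n (j.val + 1) : ℤ) * 2 ^ (a * (j.val + 1) - rsaV (j.val + 1)) * w ^ (j.val + 1)) / 2 ^ k with hγ
  have hph : ∀ y : ℕ, rsaE ((c : ℝ) * (rsaEll n (τ + 2 ^ a * (y : ℤ)) : ℤ) / 2 ^ k) =
      rsaE ((c : ℝ) * (rsaEll n τ : ℤ) / 2 ^ k) * rsaE (∑ j, γ j * (y : ℝ) ^ (j.val + 1)) := by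
    intro y
    rw [rsaE_congr k c _ _ (rsa_phase ha2 hn1 hkn hkaD hDa hDn hτ hw (y : ℤ)), ← rsaE_add]
    congr 1
    push_cast
    rw [mul_add, add_div, Finset.mul_sum, Finset.sum_div]
    congr 1
    refine Finset.sum_congr rfl fun j _ => ?_
    simp only [hγ]
    push_cast
    ring
  have hnum := rsa_numeric hp hpg hpg2 hd hL hdL hg γ (by
    intro j hj1 hj2
    set i := j.val + 1 with hi
    have hai : a * i ≤ a * (4 * d) := Nat.mul_le_mul_left _ hj2.le
    have e1 : a * (4 * d) = 2880 * (d ^ 2 * g) := by rw [ha]; ring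
    have e2 : 4320 * d ^ 2 * g = 4320 * (d ^ 2 * g) := by ring
    have e3 : 1440 * d ^ 2 * g = 1440 * (d ^ 2 * g) := by ring
    have haik : a * i ≤ k := by omega
    have hvi : rsaV i ≤ a * i := by
      have h1 := rsaV_le i (by omega)
      have h2 : rsaV i < i := (Nat.lt_two_pow_self).trans_le h1
      nlinarith
    have hin : i ≤ 2 ^ n := by omega
    refine ⟨c * (rsaO n i) * w ^ i, k - (a * i - rsaV i), (hc.mul (by exact_mod_cast rsaO_odd n i hin)).mul hwo.pow, ?_, ?_, ?_⟩
    · simp only [hγ]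
      push_cast
      have : (2 : ℝ) ^ k = 2 ^ (k - (a * i - rsaV i)) * 2 ^ (a * i - rsaV i) := by
        rw [← pow_add]; congr 1; omega
      rw [this, ← hi]
      field_simp
    · have hq : k - (a * i - rsaV i) ≤ rsaV i + a * i := by
        have : a * (6 * d) ≤ a * (2 * i) := Nat.mul_le_mul_left _ (by omega)
        have e4 : a * (2 * i) = 2 * (a * i) := by ring
        omega
      calc 2 ^ (k - (a * i - rsaV i)) ≤ 2 ^ (rsaV i + a * i) := Nat.pow_le_pow_right (by norm_num) hq
        _ = 2 ^ rsaV i * (2 ^ a) ^ i := by rw [pow_add, pow_mul]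
        _ ≤ (4320 * d ^ 2) * (p ^ (720 * d)) ^ i := by
          refine Nat.mul_le_mul ((rsaV_le i (by omega)).trans (by nlinarith)) (Nat.pow_le_pow_left ?_ _)
          rw [ha, mul_comm (720 * d) g, pow_mul]
          exact Nat.pow_le_pow_left hpg.le _
        _ ≤ _ := by omega
    · omega)
  have heq : ∑ u : Fin (p ^ (720 * d)), ∑ v : Fin (p ^ (720 * d)),
        rsaE ((c : ℝ) * (rsaEll n (τ + 2 ^ a * (((u : ℕ) * (v : ℕ) : ℕ) : ℤ)) : ℤ) / 2 ^ k) =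
      rsaE ((c : ℝ) * (rsaEll n τ : ℤ) / 2 ^ k) * ∑ u : Fin (p ^ (720 * d)), ∑ v : Fin (p ^ (720 * d)), rsaE (∑ j, γ j * (((u : ℕ) : ℝ) * ((v : ℕ) : ℝ)) ^ (j.val + 1)) := by
    rw [Finset.mul_sum]
    refine Finset.sum_congr rfl fun u _ => ?_
    rw [Finset.mul_sum]
    refine Finset.sum_congr rfl fun v _ => ?_
    rw [hph]
    push_cast
    rfl
  rw [heq, norm_mul, rsaE_norm, one_mul]
  exact hnum

lemma rsa_split (f : ℕ → ℂ) (A X : ℕ) (B : ℝ) (h : ∀ r < A, ‖∑ x ∈ Finset.range X, f (r + A * x)‖ ≤ B) :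
    ‖∑ y ∈ Finset.range (A * X), f y‖ ≤ A * B := by
  have : ∑ y ∈ Finset.range (A * X), f y = ∑ r ∈ Finset.range A, ∑ x ∈ Finset.range X, f (r + A * x) := by
    rw [Finset.sum_comm]
    clear h
    induction X with
    | zero => simp
    | succ X ih =>
      rw [Finset.sum_range_succ, mul_add, mul_one, Finset.sum_range_add, ih]
      congr 1
      refine Finset.sum_congr rfl fun r _ => by rw [add_comm]
  rw [this]
  refine (norm_sum_le _ _).trans ((Finset.sum_le_sum fun r hr => h r (Finset.mem_range.mp hr)).trans ?_)
  simp

lemma rsa_sum_large {n k d L H : ℕ} (hd : 600 ≤ d) (hL : 1 ≤ L) (hdL : 12 * d ≤ 2 ^ L) (hA : 10000000000 * d ^ 3 * L ≤ H)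
    (hB : n ≤ d * H) (hkn : k ≤ n) (hHk : H < k) (hDn : 6 * d ≤ 2 ^ n) (c : ℤ) (hc : Odd c) (t0 : ℤ) (ht0 : Odd t0) :
    ‖∑ y ∈ Finset.range (2 ^ (H - 2)), rsaE ((c : ℝ) * (rsaEll n (t0 + 4 * y) : ℤ) / 2 ^ k)‖ * 2 ^ (2 * L + 3) ≤ 2 ^ H := by
  obtain ⟨g, hg⟩ : ∃ g, g = (k + 4320 * d ^ 2 - 1) / (4320 * d ^ 2) := ⟨_, rfl⟩
  have hm : 0 < 4320 * d ^ 2 := by positivity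
  have hk2 : 4320 * d ^ 2 * g ≤ k + 4320 * d ^ 2 := by
    have := Nat.mul_div_le (k + 4320 * d ^ 2 - 1) (4320 * d ^ 2)
    rw [← hg] at this; omega
  have hk1 : k ≤ 4320 * d ^ 2 * g := by
    have := Nat.lt_mul_div_succ (k + 4320 * d ^ 2 - 1) hm
    rw [← hg, mul_add, mul_one] at this
    omega
  have hgL : 1000000 * d * L ≤ g := by
    by_contra hcon
    push Not at hcon
    have h1 : 4320 * d ^ 2 * g ≤ 4320 * d ^ 2 * (1000000 * d * L) := Nat.mul_le_mul_left _ hcon.le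
    have h2 : 4320 * d ^ 2 * (1000000 * d * L) = 4320000000 * (d ^ 3 * L) := by ring
    have h3 : 10000000000 * d ^ 3 * L = 10000000000 * (d ^ 3 * L) := by ring
    omega
  have hd2 : d ^ 2 ≤ d ^ 3 * L := by
    calc d ^ 2 = d ^ 2 * 1 * 1 := by ring
      _ ≤ d ^ 2 * d * L := by gcongr; omega
      _ = _ := by ring
  have hd1 : d ≤ d ^ 3 * L := le_trans (by nlinarith) hd2
  have hL3 : L ≤ d ^ 3 * L := Nat.le_mul_of_pos_left _ (by positivity)
  have h3 : 10000000000 * d ^ 3 * L = 10000000000 * (d ^ 3 * L) := by ring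
  have hdk : 8640 * d ^ 2 ≤ k := by omega
  obtain ⟨p, hp, hpg, hpg2⟩ := Nat.exists_prime_lt_and_le_two_mul (2 ^ g) (by positivity)
  rw [← pow_succ'] at hpg2
  obtain ⟨a, ha⟩ : ∃ a, a = 720 * d * g := ⟨_, rfl⟩
  have hga : g ≤ a := by nlinarith
  have hda : 6 * d * a ≤ d * H + 4320 * d ^ 2 := by
    have : 6 * d * a = 4320 * d ^ 2 * g := by rw [ha]; ring
    omega
  have ha6 : 6 * a ≤ H + 4320 * d := by
    have : d * (6 * a) ≤ d * (H + 4320 * d) := by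
      calc _ = 6 * d * a := by ring
        _ ≤ _ := hda
        _ = _ := by ring
    exact Nat.le_of_mul_le_mul_left this (by omega)
  have haH : 3 * a + 1440 * d + 2 * L + 3 ≤ H := by omega
  have ha2 : 2 ≤ a := by nlinarith
  set V := p ^ (720 * d) with hV
  have hVle : V ≤ 2 ^ (a + 720 * d) := by
    calc V ≤ (2 ^ (g + 1)) ^ (720 * d) := by rw [hV]; gcongr
      _ = _ := by rw [← pow_mul]; congr 1; rw [ha]; ring
  have hV1 : 1 ≤ V := Nat.one_le_pow _ _ hp.pos
  have e : 2 ^ (H - 2) = 2 ^ (a - 2) * 2 ^ (H - a) := by rw [← pow_add]; congr 1; omega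
  have key := rsa_split (fun y : ℕ => rsaE ((c : ℝ) * (rsaEll n (t0 + 4 * y) : ℤ) / 2 ^ k)) (2 ^ (a - 2)) (2 ^ (H - a))
    (((2 ^ (H - a) : ℕ) : ℝ) * (1 / 2 ^ (2 * L + 2)) + 2 * (V : ℝ) ^ 2) (by
      intro r _
      have e4 : (2 : ℤ) ^ a = 4 * 2 ^ (a - 2) := by
        rw [show (4 : ℤ) = 2 ^ 2 by norm_num, ← pow_add]; congr 1; omega
      apply rsa_shiftavg (fun x : ℕ => rsaE ((c : ℝ) * (rsaEll n (t0 + 4 * ((r + 2 ^ (a - 2) * x : ℕ) : ℤ)) : ℤ) / 2 ^ k)) (fun x => rsaE_norm _) _ V hV1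
      intro x
      have h := rsa_class hd hL hdL hgL hp hpg hpg2 hkn hdk hDn hk1 hk2 c hc (t0 + 4 * ((r + 2 ^ (a - 2) * x : ℕ) : ℤ))
        (ht0.add_even ⟨2 * ((r + 2 ^ (a - 2) * x : ℕ) : ℤ), by ring⟩)
      rw [one_div, inv_mul_eq_div, le_div_iff₀ (by positivity)]
      rw [← ha] at h
      have hVr : (V : ℝ) = (p : ℝ) ^ (720 * d) := by rw [hV]; push_cast; rfl
      rw [hVr]
      refine le_trans (le_of_eq ?_) h
      congr 2
      refine Finset.sum_congr rfl fun u _ => Finset.sum_congr rfl fun v _ => ?_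
      have e5 : t0 + 4 * ((r + 2 ^ (a - 2) * (x + (u : ℕ) * (v : ℕ)) : ℕ) : ℤ) =
          t0 + 4 * ((r + 2 ^ (a - 2) * x : ℕ) : ℤ) + 2 ^ a * (((u : ℕ) * (v : ℕ) : ℕ) : ℤ) := by
        rw [e4]; push_cast; ring
      rw [← e5])
  rw [← e] at key
  have hVr : (V : ℝ) ≤ 2 ^ (a + 720 * d) := by exact_mod_cast hVle
  calc _ ≤ ((2 ^ (a - 2) : ℕ) : ℝ) * (((2 ^ (H - a) : ℕ) : ℝ) * (1 / 2 ^ (2 * L + 2)) + 2 * (V : ℝ) ^ 2) * 2 ^ (2 * L + 3) := by gcongr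
    _ ≤ (2 : ℝ) ^ (a - 2) * ((2 : ℝ) ^ (H - a) * (1 / 2 ^ (2 * L + 2)) + 2 * (2 ^ (a + 720 * d)) ^ 2) * 2 ^ (2 * L + 3) := by
      push_cast; gcongr
    _ = (2 : ℝ) ^ (a - 2) * (2 : ℝ) ^ (H - a) * 2 + (2 : ℝ) ^ (a - 2) * 2 * (2 ^ (a + 720 * d)) ^ 2 * 2 ^ (2 * L + 3) := by
      rw [pow_succ (2 : ℝ) (2 * L + 2)]; field_simp
    _ = (2 : ℝ) ^ (H - 1) + 2 ^ (3 * a + 1440 * d + 2 * L + 2) := by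
      congr 1
      · rw [← pow_add, ← pow_succ]; congr 1; omega
      · rw [← pow_succ, ← pow_mul, ← pow_add, ← pow_add]; congr 1; omega
    _ ≤ (2 : ℝ) ^ (H - 1) + 2 ^ (H - 1) := by
      gcongr
      · norm_num
      · omega
    _ = 2 ^ H := by rw [← two_mul, ← pow_succ']; congr 1; omega

/-- central binomial bound counting the primes in (N, 2N] -/
lemma rsa_centralBinom_le (N : ℕ) (hN : 2 < N) :
    N.centralBinom ≤ (2 * N) ^ Nat.sqrt (2 * N) * 4 ^ (2 * N / 3) *
      (2 * N) ^ ((Finset.Ioc N (2 * N)).filter Nat.Prime).card := by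
  have hpos : 0 < N := by omega
  have n2_pos : 1 ≤ 2 * N := by omega
  let S := {p ∈ Finset.range (2 * N / 3 + 1) | Nat.Prime p}
  let P := (Finset.Ioc N (2 * N)).filter Nat.Prime
  let f : ℕ → ℕ := fun x => x ^ N.centralBinom.factorization x
  have hdisj : Disjoint S P := by
    rw [Finset.disjoint_left]
    intro x hx hx'
    simp only [S, P, Finset.mem_filter, Finset.mem_range, Finset.mem_Ioc] at hx hx'
    omega
  have hprod : N.centralBinom = (∏ x ∈ S, f x) * ∏ x ∈ P, f x := by
    rw [← Finset.prod_union hdisj]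
    refine (Eq.trans ?_ N.prod_pow_factorization_centralBinom).symm
    apply Finset.prod_subset
    · intro x hx
      simp only [S, P, Finset.mem_union, Finset.mem_filter, Finset.mem_range, Finset.mem_Ioc] at hx ⊢
      omega
    · intro x hx h2x
      simp only [S, P, Finset.mem_union, Finset.mem_filter, Finset.mem_range, Finset.mem_Ioc] at hx h2x
      by_cases hp : x.Prime
      · have h1 : x ≤ N := by by_contra h; exact h2x (Or.inr ⟨⟨by omega, by omega⟩, hp⟩)
        have h2 : 2 * N < 3 * x := by by_contra h; exact h2x (Or.inl ⟨by omega, hp⟩)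
        simp only [f]
        rw [Nat.factorization_centralBinom_of_two_mul_self_lt_three_mul hN h1 h2, Nat.pow_zero]
      · simp only [f]
        rw [Nat.factorization_eq_zero_of_not_prime N.centralBinom hp, Nat.pow_zero]
  have hf : ∀ p, f p ≤ 2 * N := fun p => Nat.pow_factorization_choose_le (by omega)
  rw [hprod, ← Finset.prod_filter_mul_prod_filter_not S (· ≤ Nat.sqrt (2 * N))]
  refine Nat.mul_le_mul (Nat.mul_le_mul ?_ ?_) ?_
  · refine (Finset.prod_le_prod' fun p _ => hf p).trans ?_
    have : (Finset.Icc 1 (Nat.sqrt (2 * N))).card = Nat.sqrt (2 * N) := by rw [Nat.card_Icc, Nat.add_sub_cancel]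
    rw [Finset.prod_const]
    refine pow_right_mono₀ n2_pos ((Finset.card_le_card fun x hx => ?_).trans this.le)
    obtain ⟨h1, h2⟩ := Finset.mem_filter.1 hx
    exact Finset.mem_Icc.mpr ⟨(Finset.mem_filter.1 h1).2.one_lt.le, h2⟩
  · refine le_trans ?_ (primorial_le_four_pow (2 * N / 3))
    refine (Finset.prod_le_prod' fun p hp => (?_ : f p ≤ p)).trans ?_
    · obtain ⟨h1, h2⟩ := Finset.mem_filter.1 hp
      refine (pow_right_mono₀ (Finset.mem_filter.1 h1).2.one_lt.le ?_).trans (pow_one p).le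
      exact Nat.factorization_choose_le_one (Nat.sqrt_lt'.mp <| not_le.1 h2)
    refine Finset.prod_le_prod_of_subset_of_one_le' (Finset.filter_subset _ _) ?_
    exact fun p hp _ => (Finset.mem_filter.1 hp).2.one_lt.le
  · refine (Finset.prod_le_prod' fun p _ => hf p).trans ?_
    rw [Finset.prod_const]

lemma rsa_sq_le_two_pow (n : ℕ) (hn : 16 ≤ n) : (12 * n) ^ 2 ≤ 2 ^ n := by
  induction n, hn using Nat.le_induction with
  | base => norm_num
  | succ k hk ih => rw [pow_succ 2 k]; nlinarith

/-- Chebyshev type lower bound -/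
lemma rsa_card_primes (n : ℕ) (hn : 16 ≤ n) : 2 ^ n ≤ 6 * n * (primesP n).card := by
  obtain ⟨N, hN⟩ : ∃ N, N = 2 ^ (n - 1) := ⟨_, rfl⟩
  have h2N : 2 * N = 2 ^ n := by rw [hN, ← pow_succ']; congr 1; omega
  have hsub : (Finset.Ioc N (2 * N)).filter Nat.Prime ⊆ primesP n := by
    intro p hp
    simp only [primesP, Finset.mem_filter, Finset.mem_Ioc, Finset.mem_Ioo] at hp ⊢
    refine ⟨⟨hN ▸ hp.1.1, lt_of_le_of_ne (h2N ▸ hp.1.2) ?_⟩, hp.2⟩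
    rintro rfl
    exact Nat.Prime.not_prime_pow (by omega) hp.2
  have hN4 : 4 ≤ N := by
    rw [hN]; calc 4 = 2 ^ 2 := by norm_num
      _ ≤ _ := Nat.pow_le_pow_right (by norm_num) (by omega)
  have hK := Finset.card_le_card hsub
  set K := (primesP n).card
  set K' := ((Finset.Ioc N (2 * N)).filter Nat.Prime).card
  have h1 := Nat.four_pow_lt_mul_centralBinom N hN4
  have h2 := rsa_centralBinom_le N (by omega)
  set r := Nat.sqrt (2 * N) with hr
  have h3 : 4 ^ N < 2 ^ (n - 1 + (n * r + 2 * (2 * N / 3) + n * K')) := by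
    calc 4 ^ N < N * N.centralBinom := h1
      _ ≤ N * ((2 * N) ^ r * 4 ^ (2 * N / 3) * (2 * N) ^ K') := Nat.mul_le_mul_left _ h2
      _ = _ := by
        rw [show (4 : ℕ) = 2 ^ 2 by norm_num, h2N, pow_add, pow_add, pow_add, pow_mul, pow_mul, pow_mul, ← hN]
  rw [show (4 : ℕ) = 2 ^ 2 by norm_num, ← pow_mul, Nat.pow_lt_pow_iff_right (by norm_num)] at h3
  have h4 := rsa_sq_le_two_pow n hn
  have hr1 : 12 * n ≤ r := by rw [hr, Nat.le_sqrt', h2N]; exact h4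
  have hr2 : r * r ≤ 2 * N := Nat.sqrt_le _
  have h5 : n * K' ≤ n * K := Nat.mul_le_mul_left _ hK
  have h6 : 12 * n * r ≤ r * r := Nat.mul_le_mul_right _ hr1
  have h7 : n ≤ n * r := Nat.le_mul_of_pos_right _ (by omega)
  have e1 : 12 * n * r = 12 * (n * r) := by ring
  have e2 : 6 * n * K = 6 * (n * K) := by ring
  rw [← h2N, e2]
  omega

open scoped ComplexConjugate in
/-- counting solutions by characters -/
lemma rsa_count {Q : ℕ} [NeZero Q] (A : Finset ℕ) (a b : ℕ → ZMod Q) (R : ℕ) (B : ℝ)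
    (ha : ∀ p ∈ A, ∀ q ∈ A, a p = a q → p = q)
    (hb : ∀ y ∈ Finset.range R, ∀ z ∈ Finset.range R, b y = b z → y = z)
    (hB : ∀ c : ZMod Q, 4 * c ≠ 0 → ‖∑ y ∈ Finset.range R, ZMod.stdAddChar (-(c * b y))‖ ≤ B)
    (hA4 : ∀ c : ZMod Q, 4 * c = 0 → ∀ p ∈ A, c * a p = 0)
    (hb4 : ∀ c : ZMod Q, 4 * c = 0 → ∀ y ∈ Finset.range R, c * b y = 0)
    (hApos : 0 < A.card) (hbig : (Q : ℝ) * (B + 1) < A.card * R) (hB0 : 0 ≤ B) :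
    ∃ p ∈ A, ∃ l ∈ A, ∃ y ∈ Finset.range R, p ≠ l ∧ a p + a l = b y := by
  classical
  by_contra hcon
  push Not at hcon
  have orth : ∀ z : ZMod Q, ∑ c : ZMod Q, ZMod.stdAddChar (c * z) = if z = 0 then (Q : ℂ) else 0 := by
    intro z
    have := AddChar.sum_mulShift (ψ := ZMod.stdAddChar (N := Q)) z (ZMod.isPrimitive_stdAddChar Q)
    rw [ZMod.card] at this
    rw [this]
    split_ifs <;> simp
  set f : ZMod Q → ℂ := fun c => ∑ p ∈ A, ZMod.stdAddChar (c * a p) with hf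
  set T : ZMod Q → ℂ := fun c => ∑ y ∈ Finset.range R, ZMod.stdAddChar (-(c * b y)) with hT
  -- second moment
  have hsq : ∑ c : ZMod Q, ‖f c‖ ^ 2 = (Q : ℝ) * A.card := by
    have h1 : ∀ c, ((‖f c‖ ^ 2 : ℝ) : ℂ) = ∑ p ∈ A, ∑ q ∈ A, ZMod.stdAddChar (c * (a p - a q)) := by
      intro c
      push_cast
      rw [← Complex.mul_conj', hf, map_sum, Finset.sum_mul_sum]
      refine Finset.sum_congr rfl fun p _ => Finset.sum_congr rfl fun q _ => ?_
      rw [← AddChar.map_neg_eq_conj, ← AddChar.map_add_eq_mul]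
      congr 1; ring
    have h2 : ((∑ c : ZMod Q, ‖f c‖ ^ 2 : ℝ) : ℂ) = (Q : ℂ) * A.card := by
      push_cast
      have : ∀ c ∈ (Finset.univ : Finset (ZMod Q)), ((‖f c‖ : ℂ) ^ 2) = ∑ p ∈ A, ∑ q ∈ A, ZMod.stdAddChar (c * (a p - a q)) := by
        intro c _; rw [← h1]; push_cast; rfl
      rw [Finset.sum_congr rfl this, Finset.sum_comm]
      have : ∀ p ∈ A, ∑ c : ZMod Q, ∑ q ∈ A, ZMod.stdAddChar (c * (a p - a q)) = (Q : ℂ) := by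
        intro p hp
        rw [Finset.sum_comm, Finset.sum_congr rfl fun q _ => orth (a p - a q), Finset.sum_eq_single p]
        · simp
        · intro q hq hqp
          rw [if_neg]
          intro h
          exact hqp (ha p hp q hq (sub_eq_zero.mp h)).symm
        · intro h; exact absurd hp h
      rw [Finset.sum_congr rfl this, Finset.sum_const, nsmul_eq_mul, mul_comm]
    exact_mod_cast h2
  -- counting
  have hcount : ∑ c : ZMod Q, f c ^ 2 * T c = ∑ p ∈ A, ∑ l ∈ A, ∑ y ∈ Finset.range R, if a p + a l - b y = 0 then (Q : ℂ) else 0 := by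
    have h1 : ∀ c ∈ (Finset.univ : Finset (ZMod Q)), f c ^ 2 * T c = ∑ p ∈ A, ∑ l ∈ A, ∑ y ∈ Finset.range R, ZMod.stdAddChar (c * (a p + a l - b y)) := by
      intro c _
      rw [sq, hf, hT, Finset.sum_mul_sum, Finset.sum_mul]
      refine Finset.sum_congr rfl fun p _ => ?_
      rw [Finset.sum_mul]
      refine Finset.sum_congr rfl fun l _ => ?_
      rw [Finset.mul_sum]
      refine Finset.sum_congr rfl fun y _ => ?_
      rw [← AddChar.map_add_eq_mul, ← AddChar.map_add_eq_mul]
      congr 1; ring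
    rw [Finset.sum_congr rfl h1, Finset.sum_comm]
    refine Finset.sum_congr rfl fun p _ => ?_
    rw [Finset.sum_comm]
    refine Finset.sum_congr rfl fun l _ => ?_
    rw [Finset.sum_comm]
    exact Finset.sum_congr rfl fun y _ => orth _
  have hupper : ‖∑ c : ZMod Q, f c ^ 2 * T c‖ ≤ (A.card : ℝ) * Q := by
    rw [hcount]
    refine (norm_sum_le _ _).trans ?_
    rw [← nsmul_eq_mul]
    refine Finset.sum_le_card_nsmul _ _ _ fun p hp => ?_
    rw [Finset.sum_eq_single p]
    · by_cases hy : ∃ y ∈ Finset.range R, a p + a p - b y = 0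
      · obtain ⟨y, hy, hy2⟩ := hy
        rw [Finset.sum_eq_single y]
        · rw [if_pos hy2]; simp
        · intro z hz hzy
          rw [if_neg]
          intro h
          refine hzy (hb z hz y hy ?_)
          rw [← sub_eq_zero.mp h, sub_eq_zero.mp hy2]
        · intro h; exact absurd hy h
      · push Not at hy
        rw [Finset.sum_eq_zero]
        · simp
        · intro y hyr
          rw [if_neg (hy y hyr)]
    · intro l hl hlp
      refine Finset.sum_eq_zero fun y hy => ?_
      rw [if_neg]
      intro h
      exact hcon p hp l hl y hy hlp.symm (sub_eq_zero.mp h)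
    · intro h; exact absurd hp h
  set C0 : Finset (ZMod Q) := Finset.univ.filter (fun c => 4 * c = 0) with hC0
  have hsplit := Finset.sum_filter_add_sum_filter_not (Finset.univ : Finset (ZMod Q)) (fun c => 4 * c = 0) (fun c => f c ^ 2 * T c)
  have hmain : ∑ c ∈ Finset.univ.filter (fun c : ZMod Q => 4 * c = 0), f c ^ 2 * T c = (C0.card : ℂ) * ((A.card : ℂ) ^ 2 * R) := by
    rw [← nsmul_eq_mul]
    refine Finset.sum_eq_card_nsmul fun c hc => ?_
    have hc' : 4 * c = 0 := (Finset.mem_filter.mp hc).2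
    have e1 : f c = A.card := by
      rw [hf]
      simp only
      rw [Finset.sum_congr rfl fun p hp => by rw [hA4 c hc' p hp, AddChar.map_zero_eq_one]]
      simp
    have e2 : T c = R := by
      rw [hT]
      simp only
      rw [Finset.sum_congr rfl fun p hp => by rw [hb4 c hc' p hp, neg_zero, AddChar.map_zero_eq_one]]
      simp
    rw [e1, e2]
  have hrest : ‖∑ c ∈ Finset.univ.filter (fun c : ZMod Q => ¬ 4 * c = 0), f c ^ 2 * T c‖ ≤ (Q : ℝ) * A.card * B := by
    refine (norm_sum_le _ _).trans ?_
    rw [← hsq, Finset.sum_mul]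
    refine (Finset.sum_le_sum (g := fun c => ‖f c‖ ^ 2 * B) fun c hc => ?_).trans
      (Finset.sum_le_sum_of_subset_of_nonneg (Finset.filter_subset _ _) fun c _ _ => by positivity)
    rw [norm_mul, norm_pow]
    exact mul_le_mul_of_nonneg_left (hB c (Finset.mem_filter.mp hc).2) (by positivity)
  have hC1 : (1 : ℝ) ≤ C0.card := by
    have : 0 < C0.card := Finset.card_pos.mpr ⟨0, by simp [hC0]⟩
    exact_mod_cast this
  have hfin : (C0.card : ℝ) * ((A.card : ℝ) ^ 2 * R) ≤ A.card * Q + Q * A.card * B := by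
    have h1 : ‖(C0.card : ℂ) * ((A.card : ℂ) ^ 2 * R)‖ = (C0.card : ℝ) * ((A.card : ℝ) ^ 2 * R) := by simp
    rw [← h1, ← hmain, eq_sub_of_add_eq hsplit]
    exact (norm_sub_le _ _).trans (add_le_add hupper hrest)
  have hAr : (0 : ℝ) < A.card := by exact_mod_cast hApos
  have h2 : (A.card : ℝ) ^ 2 * R ≤ (C0.card : ℝ) * ((A.card : ℝ) ^ 2 * R) := le_mul_of_one_le_left (by positivity) hC1
  have h3 := mul_lt_mul_of_pos_left hbig hAr
  nlinarith

/-- bound on the twisted sums for non trivial frequencies -/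
lemma rsa_T_bound {n d L H : ℕ} (hd : 600 ≤ d) (hL : 1 ≤ L) (hdL : 12 * d ≤ 2 ^ L)
    (hA : 10000000000 * d ^ 3 * L ≤ H) (hB : n ≤ d * H) (hDn : 6 * d ≤ 2 ^ n) (hn : 1 ≤ n)
    (t0 : ℤ) (ht0 : Odd t0) [NeZero (2 ^ n)] (c : ZMod (2 ^ n)) (hc : 4 * c ≠ 0) :
    ‖∑ y ∈ Finset.range (2 ^ (H - 2)), ZMod.stdAddChar (-(c * ((rsaEll n (t0 + 4 * y) : ℤ) : ZMod (2 ^ n))))‖ ≤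
      2 ^ H / 2 ^ (2 * L + 3) := by
  have hv0 : c.val ≠ 0 := by
    intro h
    rw [ZMod.val_eq_zero] at h
    exact hc (by rw [h, mul_zero])
  obtain ⟨e, c', hc'o, hce⟩ := Nat.exists_eq_two_pow_mul_odd hv0
  have hcz : c = ((2 ^ e * (c' : ℤ) : ℤ) : ZMod (2 ^ n)) := by
    rw [← ZMod.natCast_zmod_val c, hce]; push_cast; rfl
  have hk : e + 3 ≤ n := by
    by_contra hlt
    apply hc
    have : (4 : ZMod (2 ^ n)) * c = ((2 ^ (e + 2) * c' : ℕ) : ZMod (2 ^ n)) := by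
      rw [hcz]; push_cast; ring
    rw [this, ZMod.natCast_eq_zero_iff]
    exact (pow_dvd_pow 2 (by omega)).trans (dvd_mul_right _ _)
  obtain ⟨k, hkn⟩ : ∃ k, n = e + k := ⟨n - e, by omega⟩
  have hco : Odd (-(c' : ℤ)) := (show Odd (c' : ℤ) by exact_mod_cast hc'o).neg
  have hterm : ∀ y ∈ Finset.range (2 ^ (H - 2)), ZMod.stdAddChar (-(c * ((rsaEll n (t0 + 4 * y) : ℤ) : ZMod (2 ^ n)))) =
      rsaE (((-(c' : ℤ) : ℤ) : ℝ) * (rsaEll n (t0 + 4 * y) : ℤ) / 2 ^ k) := by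
    intro y _
    have h := rsaE_zmod (2 ^ n) (-((2 ^ e * (c' : ℤ)) * rsaEll n (t0 + 4 * y)))
    rw [hcz]
    have e1 : (-(((2 ^ e * (c' : ℤ) : ℤ) : ZMod (2 ^ n)) * ((rsaEll n (t0 + 4 * y) : ℤ) : ZMod (2 ^ n)))) =
        ((-((2 ^ e * (c' : ℤ)) * rsaEll n (t0 + 4 * y)) : ℤ) : ZMod (2 ^ n)) := by
      push_cast; ring
    rw [e1, ← h]
    congr 1
    push_cast
    have e2 : (2 : ℝ) ^ n = 2 ^ e * 2 ^ k := by rw [hkn, pow_add]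
    rw [e2]
    field_simp
  rw [Finset.sum_congr rfl hterm]
  by_cases hkH : k ≤ H
  · rw [rsa_sum_small hn (by omega) hkH _ hco t0 ht0, norm_zero]
    positivity
  · rw [le_div_iff₀ (by positivity)]
    exact rsa_sum_large hd hL hdL hA hB (by omega) (by omega) hDn _ hco t0 ht0

lemma rsa_core {n d L H s : ℕ} (hd : 600 ≤ d) (hdL : 12 * d ≤ 2 ^ L) (hnL : n < 2 ^ L)
    (hA : 10000000000 * d ^ 3 * L ≤ H) (hB : n ≤ d * H) (hDn : 6 * d ≤ 2 ^ n) (hn : 16 ≤ n) (hHn : H ≤ n)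
    (hs : s < 2 ^ (n - H)) :
    ∃ p ℓ : ℕ, p ∈ primesP n ∧ ℓ ∈ primesP n ∧ p ≠ ℓ ∧ (p * ℓ % 2 ^ n) / 2 ^ H = s := by
  have hL4 : 4 ≤ L := by
    by_contra h
    have : 2 ^ L ≤ 2 ^ 3 := Nat.pow_le_pow_right (by norm_num) (by omega)
    omega
  have hL1 : 1 ≤ L := by omega
  have hHL : L + 7 ≤ H := by
    refine le_trans ?_ hA
    have : 1 ≤ d ^ 3 := Nat.one_le_pow _ _ (by omega)
    nlinarith
  have h4H : 2 ^ H = 4 * 2 ^ (H - 2) := by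
    rw [show 4 = 2 ^ 2 by norm_num, ← pow_add]; congr 1; omega
  have h2n : 2 ^ n = 2 ^ (n - H) * 2 ^ H := by rw [← pow_add]; congr 1; omega
  have : NeZero (2 ^ n) := ⟨by positivity⟩
  have hodd : ∀ p ∈ primesP n, p % 2 = 1 := by
    intro p hp
    simp only [primesP, Finset.mem_filter, Finset.mem_Ioo] at hp
    rcases hp.2.eq_two_or_odd with h | h
    · exfalso
      have : 2 ^ 1 ≤ 2 ^ (n - 1) := Nat.pow_le_pow_right (by norm_num) (by omega)
      omega
    · exact h
  obtain ⟨i, hi⟩ : ∃ i, (i = 1 ∨ i = 3) ∧ (primesP n).card ≤ 2 * ((primesP n).filter (fun p => p % 4 = i)).card := by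
    have h1 : primesP n ⊆ (primesP n).filter (fun p => p % 4 = 1) ∪ (primesP n).filter (fun p => p % 4 = 3) := by
      intro p hp
      have := hodd p hp
      simp only [Finset.mem_union, Finset.mem_filter]
      rcases (show p % 4 = 1 ∨ p % 4 = 3 by omega) with h | h
      · exact Or.inl ⟨hp, h⟩
      · exact Or.inr ⟨hp, h⟩
    have h2 := (Finset.card_le_card h1).trans (Finset.card_union_le _ _)
    rcases le_total ((primesP n).filter (fun p => p % 4 = 1)).card ((primesP n).filter (fun p => p % 4 = 3)).card with h | h
    · exact ⟨3, Or.inr rfl, by omega⟩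
    · exact ⟨1, Or.inl rfl, by omega⟩
  obtain ⟨hi, hcard⟩ := hi
  set A := (primesP n).filter (fun p => p % 4 = i) with hAdef
  have hcard2 : 2 ^ n ≤ 12 * n * A.card := by
    refine (rsa_card_primes n hn).trans ?_
    calc 6 * n * (primesP n).card ≤ 6 * n * (2 * A.card) := Nat.mul_le_mul_left _ hcard
      _ = _ := by ring
  have hApos : 0 < A.card := by
    rcases Nat.eq_zero_or_pos A.card with h | h
    · rw [h] at hcard2
      have : 0 < 2 ^ n := by positivity
      omega
    · exact h
  have hn1 : 1 ≤ n := by omega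
  have hAodd : ∀ p ∈ A, Odd (p : ℤ) := by
    intro p hp
    have := hodd p (Finset.mem_filter.mp hp).1
    exact_mod_cast Nat.odd_iff.mpr this
  have hAlt : ∀ p ∈ A, p < 2 ^ n := by
    intro p hp
    have := (Finset.mem_filter.mp hp).1
    simp only [primesP, Finset.mem_filter, Finset.mem_Ioo] at this
    exact this.1.2
  have hA4 : ∀ p ∈ A, p % 4 = i := fun p hp => (Finset.mem_filter.mp hp).2
  set t0 : ℤ := s * 2 ^ H + 1 with ht0d
  have h4Hz : (2 : ℤ) ^ H = 4 * 2 ^ (H - 2) := by exact_mod_cast h4H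
  have ht0 : Odd t0 := ⟨s * (2 * 2 ^ (H - 2)), by rw [ht0d, h4Hz]; ring⟩
  have hto : ∀ y : ℕ, Odd (t0 + 4 * (y : ℤ)) := fun y => ht0.add_even ⟨2 * y, by ring⟩
  have hzero4 : ∀ (c : ZMod (2 ^ n)) (z : ℤ), Odd z → 4 * c = 0 → c * ((rsaEll n z : ℤ) : ZMod (2 ^ n)) = 0 := by
    intro c z hz hc
    obtain ⟨w, hw⟩ := rsa_ell_four n hz hn1
    rw [hw]; push_cast
    rw [← mul_assoc, mul_comm c 4, hc, zero_mul]
  have hzeq : ∀ x y : ℤ, ((x : ℤ) : ZMod (2 ^ n)) = (y : ZMod (2 ^ n)) → (2 : ℤ) ^ n ∣ x - y := by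
    intro x y h
    have := (ZMod.intCast_eq_intCast_iff_dvd_sub y x (2 ^ n)).mp h.symm
    exact_mod_cast this
  obtain ⟨p, hp, l, hl, y, hy, hpl, heq⟩ := rsa_count A (fun p => ((rsaEll n p : ℤ) : ZMod (2 ^ n)))
    (fun y => ((rsaEll n (t0 + 4 * y) : ℤ) : ZMod (2 ^ n))) (2 ^ (H - 2)) (2 ^ H / 2 ^ (2 * L + 3))
    (by
      intro p hp q hq h
      have h4 : (4 : ℤ) ∣ p - q := by have := hA4 p hp; have := hA4 q hq; omega
      have := rsa_ell_inj n (hAodd p hp) (hAodd q hq) hn1 h4 (hzeq _ _ h)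
      have hpl := hAlt p hp
      have hql := hAlt q hq
      have h5 := Int.eq_zero_of_abs_lt_dvd this (by
        rw [abs_lt]
        have h6 : (p : ℤ) < 2 ^ n := by exact_mod_cast hpl
        have h7 : (q : ℤ) < 2 ^ n := by exact_mod_cast hql
        omega)
      omega)
    (by
      intro y hy z hz h
      rw [Finset.mem_range] at hy hz
      have := rsa_ell_inj n (hto y) (hto z) hn1 ⟨y - z, by ring⟩ (hzeq _ _ h)
      have hy' : (y : ℤ) < 2 ^ (H - 2) := by exact_mod_cast hy
      have hz' : (z : ℤ) < 2 ^ (H - 2) := by exact_mod_cast hz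
      have hle : (2 : ℤ) ^ H ≤ 2 ^ n := pow_le_pow_right₀ (by norm_num) hHn
      have h5 := Int.eq_zero_of_abs_lt_dvd this (by
        rw [abs_lt]
        omega)
      omega)
    (fun c hc => rsa_T_bound hd hL1 hdL hA hB hDn hn1 t0 ht0 c hc)
    (fun c hc p hp => hzero4 c p (hAodd p hp) hc)
    (fun c hc y _ => hzero4 c _ (hto y) hc)
    hApos
    (by
      have hc2 : (2 : ℝ) ^ n ≤ 12 * n * A.card := by exact_mod_cast hcard2
      have hAr : (0 : ℝ) < A.card := by exact_mod_cast hApos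
      have hnr : (n : ℝ) < 2 ^ L := by exact_mod_cast hnL
      have h16 : (16 : ℝ) ≤ 2 ^ L := by
        calc (16 : ℝ) = 2 ^ 4 := by norm_num
          _ ≤ 2 ^ L := pow_le_pow_right₀ (by norm_num) hL4
      have h7 : (2 : ℝ) ^ L * 128 ≤ 2 ^ H := by
        calc (2 : ℝ) ^ L * 128 = 2 ^ (L + 7) := by rw [pow_add]; norm_num
          _ ≤ _ := pow_le_pow_right₀ (by norm_num) hHL
      have h8 : (2 : ℝ) ^ (H - 2) = 2 ^ H / 4 := by
        have : (2 : ℝ) ^ H = 4 * 2 ^ (H - 2) := by exact_mod_cast h4H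
        linarith
      have hX : (2 : ℝ) ^ H / 2 ^ (2 * L + 3) * 2 ^ L ≤ 2 ^ H / 128 := by
        have : (2 : ℝ) ^ (2 * L + 3) = 2 ^ L * 2 ^ L * 8 := by rw [two_mul, pow_add, pow_add]; norm_num
        rw [this, div_mul_eq_mul_div, div_le_div_iff₀ (by positivity) (by norm_num)]
        have h9 : (0 : ℝ) < 2 ^ H * 2 ^ L := by positivity
        nlinarith
      have hX0 : (0 : ℝ) ≤ 2 ^ H / 2 ^ (2 * L + 3) := by positivity
      push_cast
      rw [h8]
      set X := (2 : ℝ) ^ H / 2 ^ (2 * L + 3) with hXd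
      have hnX : (n : ℝ) * (X + 1) < 2 ^ H / 48 := by
        have : (n : ℝ) * (X + 1) ≤ 2 ^ L * (X + 1) := by gcongr
        nlinarith [show (0 : ℝ) < 2 ^ H by positivity]
      calc (2 : ℝ) ^ n * (X + 1) ≤ 12 * n * A.card * (X + 1) := by gcongr
        _ = A.card * (12 * (n * (X + 1))) := by ring
        _ < A.card * (2 ^ H / 4) := by
          apply mul_lt_mul_of_pos_left _ hAr
          linarith)
    (by positivity)
  refine ⟨p, l, (Finset.mem_filter.mp hp).1, (Finset.mem_filter.mp hl).1, hpl, ?_⟩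
  have hpo := hAodd p hp
  have hlo := hAodd l hl
  rw [Finset.mem_range] at hy
  have h4 : (4 : ℤ) ∣ p * l - (t0 + 4 * y) := by
    have e1 : (4 : ℤ) ∣ p * l - 1 := by
      have h1 := hA4 p hp
      have h2 := hA4 l hl
      have h3 : (p * l) % 4 = 1 := by
        rw [Nat.mul_mod, h1, h2]
        rcases hi with rfl | rfl <;> rfl
      have h5 : ((p * l : ℕ) : ℤ) = p * l := by push_cast; rfl
      omega
    have e2 : (p * l : ℤ) - (t0 + 4 * y) = (p * l - 1) - 4 * (s * 2 ^ (H - 2) + y) := by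
      rw [ht0d, h4Hz]; ring
    rw [e2]
    exact dvd_sub e1 (dvd_mul_right _ _)
  have hdiv : (2 : ℤ) ^ n ∣ rsaEll n (p * l) - rsaEll n (t0 + 4 * y) := by
    have h1 : (2 : ℤ) ^ n ∣ (rsaEll n p + rsaEll n l) - rsaEll n (t0 + 4 * y) := by
      apply hzeq
      push_cast
      exact heq
    rw [rsa_ell_mul n hpo hlo hn1]
    have := dvd_add h1 (dvd_mul_right ((2 : ℤ) ^ n) (rsaEll n p * rsaEll n l))
    rwa [add_sub_right_comm]
  have hfin := rsa_ell_inj n (hpo.mul hlo) (hto y) hn1 h4 hdiv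
  have hmod : p * l % 2 ^ n = s * 2 ^ H + (1 + 4 * y) := by
    have hlt : s * 2 ^ H + (1 + 4 * y) < 2 ^ n := by
      have : (s + 1) * 2 ^ H ≤ 2 ^ (n - H) * 2 ^ H := Nat.mul_le_mul_right _ hs
      rw [← h2n] at this
      have e : (s + 1) * 2 ^ H = s * 2 ^ H + 2 ^ H := by ring
      omega
    have hm : (s * 2 ^ H + (1 + 4 * y)) ≡ p * l [MOD 2 ^ n] := by
      rw [Nat.modEq_iff_dvd]
      push_cast
      rw [ht0d] at hfin
      convert hfin using 1
      ring
    rw [← Nat.mod_eq_of_lt hlt]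
    exact hm.symm
  rw [hmod, mul_comm s, Nat.mul_add_div (by positivity), Nat.div_eq_of_lt (by omega), add_zero]

/-- For all sufficiently large `n`, with `m = ⌊n - n^(3/4) * ln n⌋`, for every `s < 2^m`
there are distinct primes `p, ℓ ∈ 𝒫 n` such that the bits of `M = p * ℓ` at positions
`n-1, …, n-m` form the binary representation of `s`. -/
theorem rsa_moduli_prescribed_bits :
    ∃ n₀ : ℕ, ∀ n : ℕ, n₀ ≤ n →
      ∀ s : ℕ, s < 2 ^ ⌊(n : ℝ) - (n : ℝ) ^ ((3 : ℝ)/4) * Real.log n⌋₊ →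
        ∃ p ℓ : ℕ, p ∈ primesP n ∧ ℓ ∈ primesP n ∧ p ≠ ℓ ∧
          (p * ℓ % 2 ^ n) / 2 ^ (n - ⌊(n : ℝ) - (n : ℝ) ^ ((3 : ℝ)/4) * Real.log n⌋₊) = s := by
  have ev1 : ∀ᶠ n : ℕ in Filter.atTop, (10000 : ℝ) ≤ Real.log n :=
    (Real.tendsto_log_atTop.comp tendsto_natCast_atTop_atTop).eventually_ge_atTop 10000
  have ev2 : ∀ᶠ n : ℕ in Filter.atTop, ‖Real.log n‖ ≤ (1 / 600 : ℝ) * ‖(n : ℝ) ^ (1 / 4 : ℝ)‖ :=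
    tendsto_natCast_atTop_atTop.eventually
      ((isLittleO_log_rpow_atTop (show (0 : ℝ) < 1 / 4 by norm_num)).def (by norm_num : (0 : ℝ) < 1 / 600))
  obtain ⟨n₀, hn₀⟩ := Filter.eventually_atTop.mp (ev1.and (ev2.and (Filter.eventually_ge_atTop 16)))
  refine ⟨n₀, fun n hn s hs => ?_⟩
  obtain ⟨h1, h2, h16⟩ := hn₀ n hn
  set x : ℝ := (n : ℝ) ^ (1 / 4 : ℝ) with hx
  set lg : ℝ := Real.log n with hlg
  have hn0 : (0 : ℝ) ≤ n := Nat.cast_nonneg n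
  have hx0 : 0 ≤ x := Real.rpow_nonneg hn0 _
  have hx4 : x ^ 4 = n := by
    rw [hx, ← Real.rpow_natCast, ← Real.rpow_mul hn0]; norm_num
  have hx3 : (n : ℝ) ^ ((3 : ℝ) / 4) = x ^ 3 := by
    rw [hx, ← Real.rpow_natCast, ← Real.rpow_mul hn0]; norm_num
  rw [hx3] at hs ⊢
  rw [Real.norm_of_nonneg (by linarith), Real.norm_of_nonneg hx0] at h2
  have hxl : 600 * lg ≤ x := by linarith
  have hlg0 : 0 < lg := by linarith
  set m := ⌊(n : ℝ) - x ^ 3 * lg⌋₊ with hm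
  have hX : 0 ≤ (n : ℝ) - x ^ 3 * lg := by
    have : x ^ 3 * lg ≤ x ^ 3 * x := by gcongr; linarith
    have : x ^ 3 * x = x ^ 4 := by ring
    linarith
  have hmX : (m : ℝ) ≤ n - x ^ 3 * lg := Nat.floor_le hX
  have hmn : m ≤ n := by
    have : (m : ℝ) ≤ n := by
      have : 0 ≤ x ^ 3 * lg := by positivity
      linarith
    exact_mod_cast this
  have hH : x ^ 3 * lg ≤ ((n - m : ℕ) : ℝ) := by
    rw [Nat.cast_sub hmn]; linarith
  set H := n - m with hHd
  set d := ⌈x / lg⌉₊ with hd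
  set L := Nat.log 2 n + 1 with hL
  have hd1 : x / lg ≤ d := Nat.le_ceil _
  have hq : 600 ≤ x / lg := by rw [le_div_iff₀ hlg0]; exact hxl
  have hd2 : (d : ℝ) ≤ 2 * (x / lg) := by
    have := Nat.ceil_lt_add_one (show 0 ≤ x / lg by positivity)
    linarith
  have hd600 : 600 ≤ d := by
    have : (600 : ℝ) ≤ d := hq.trans hd1
    exact_mod_cast this
  have hdx : (d : ℝ) ≤ x := by
    refine hd2.trans ?_
    rw [← mul_div_assoc, div_le_iff₀ hlg0]
    nlinarith
  have hnL : n < 2 ^ L := Nat.lt_pow_succ_log_self (by norm_num) n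
  have h12 : 12 * d ≤ n := by
    have : (12 : ℝ) * d ≤ n := by
      rw [← hx4]
      have h3 : (12 : ℝ) ≤ x ^ 3 := by
        calc (12 : ℝ) ≤ 12 ^ 3 := by norm_num
          _ ≤ x ^ 3 := by gcongr; linarith
      calc (12 : ℝ) * d ≤ x ^ 3 * x := by gcongr
        _ = x ^ 4 := by ring
    exact_mod_cast this
  have hL3 : (L : ℝ) ≤ 3 * lg := by
    have h3 : 2 ^ Nat.log 2 n ≤ n := Nat.pow_log_le_self 2 (by omega)
    have h4 : ((2 : ℝ)) ^ Nat.log 2 n ≤ n := by exact_mod_cast h3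
    have h5 := Real.log_le_log (by positivity) h4
    rw [Real.log_pow] at h5
    have h6 := Real.log_two_gt_d9
    have h7 : (0 : ℝ) ≤ Nat.log 2 n := Nat.cast_nonneg _
    rw [hL]; push_cast
    nlinarith
  refine rsa_core (d := d) (L := L) hd600 (h12.trans hnL.le) hnL ?_ ?_ ?_ h16 (Nat.sub_le _ _) ?_
  · have : (10000000000 : ℝ) * d ^ 3 * L ≤ H := by
      refine le_trans ?_ hH
      calc (10000000000 : ℝ) * d ^ 3 * L ≤ 10000000000 * (2 * (x / lg)) ^ 3 * (3 * lg) := by gcongr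
        _ = 240000000000 * x ^ 3 / lg ^ 2 := by field_simp; ring
        _ ≤ x ^ 3 * lg := by
          rw [div_le_iff₀ (by positivity)]
          have h3 : (240000000000 : ℝ) ≤ lg ^ 3 := by
            calc (240000000000 : ℝ) ≤ 10000 ^ 3 := by norm_num
              _ ≤ lg ^ 3 := by gcongr
          calc 240000000000 * x ^ 3 ≤ lg ^ 3 * x ^ 3 := by gcongr
            _ = x ^ 3 * lg * lg ^ 2 := by ring
    exact_mod_cast this
  · have : (n : ℝ) ≤ d * H := by
      calc (n : ℝ) = (x / lg) * (x ^ 3 * lg) := by rw [← hx4]; field_simp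
        _ ≤ d * H := by gcongr
    exact_mod_cast this
  · have : n < 2 ^ n := Nat.lt_two_pow_self
    omega
  · rw [show n - H = m by omega]
    exact hs
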